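/- Suppose μ1 > μ2, γ1 ≠ γ2 and γ1 ≤ (μ2/μ1)·γ2. Then the unique EAP of the HDS is the piecewise-linear profile with F1′(t) = μ1·γ1 for t ∈ [T_{1,a}, T_{1,f}] and F1′(t) = 0 otherwise, and F2′(t) = μ2·γ2 for t ∈ [T_{2,a}, T_{2,f}] and F2′(t) = 0 otherwise, where T_{1,a} = −(1/γ1 − 1)·Λ1/μ1 − (1/γ2 − 1)·Λ2/μ2, T_{1,f} = T_{2,a} = Λ1/μ1 − (1/γ2 − 1)·Λ2/μ2, and T_{2,f} = Λ1/μ1 + Λ2/μ2. -/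

import Mathlib

open Set Filter MeasureTheory

noncomputable section

/-- Absolute continuity of a real function (standard ε–δ definition over finite
families of intervals with pairwise disjoint interiors). -/
def IsAbsolutelyContinuous (F : ℝ → ℝ) : Prop :=
  ∀ ε > 0, ∃ δ > 0, ∀ n : ℕ, ∀ a b : Fin n → ℝ,
    (∀ i, a i ≤ b i) →
    (∀ i j, i ≠ j → Disjoint (Set.Ioo (a i) (b i)) (Set.Ioo (a j) (b j))) →
    (∑ i, (b i - a i)) < δ → (∑ i, |F (b i) - F (a i)|) < ε

/-- A "discrete" (pure jump) function: constant on intervals avoiding a countable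
set of jump points. -/
def IsJumpFunction (h : ℝ → ℝ) : Prop :=
  ∃ D : Set ℝ, D.Countable ∧ ∀ a b : ℝ, a ≤ b → (∀ x ∈ D, x ∉ Set.Ioc a b) → h b = h a

/-- An arrival profile of total mass `Λ`: nondecreasing, right-continuous, with
limits `0` at `-∞` and `Λ` at `+∞`, taking values in `[0, Λ]`, and expressible as a
sum of a nondecreasing absolutely continuous function and a nondecreasing discrete
function. -/
structure ArrivalProfile (Λ : ℝ) where
  F : ℝ → ℝ
  mono : Monotone F
  rightCont : ∀ t : ℝ, ContinuousWithinAt F (Set.Ici t) t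
  tendsto_bot : Tendsto F atBot (nhds 0)
  tendsto_top : Tendsto F atTop (nhds Λ)
  mem_Icc : ∀ t : ℝ, F t ∈ Set.Icc (0 : ℝ) Λ
  decomp : ∃ g h : ℝ → ℝ, Monotone g ∧ IsAbsolutelyContinuous g ∧
      Monotone h ∧ IsJumpFunction h ∧ F = fun t => g t + h t

/-- Queue length at time `t` of a queue with service rate `μ`, opening at time `0`,
facing the cumulative arrival profile `A`:
`Q(t) = A(t) − μ·max{t,0} + sup_{s ∈ [0,t]} max{μs − A(s), 0}`
(the supremum being `0` when `t < 0`, via `Real.sSup ∅ = 0`). -/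
def queueLen (μ : ℝ) (A : ℝ → ℝ) (t : ℝ) : ℝ :=
  A t - μ * max t 0 + sSup ((fun s => max (μ * s - A s) 0) '' Set.Icc 0 t)

/-- Expected waiting time of a customer arriving at time `t`:
`W(t) = (Q(t+) + Q(t−))/(2μ) + max{0, −t}`.  (When the arrival profile is
absolutely continuous the queue length is continuous and this is
`Q(t)/μ + max{0,−t}`.) -/
def wait (μ : ℝ) (A : ℝ → ℝ) (t : ℝ) : ℝ :=
  (Function.rightLim (queueLen μ A) t + Function.leftLim (queueLen μ A) t) / (2 * μ)
    + max 0 (-t)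

/-- Departure time of a customer arriving at time `t`: `τ(t) = t + W(t)`. -/
def depart (μ : ℝ) (A : ℝ → ℝ) (t : ℝ) : ℝ := t + wait μ A t

/-- Generalized inverse `τ⁻¹(t) = sup {s : τ(s) ≤ t}` of the departure time. -/
def departInv (μ : ℝ) (A : ℝ → ℝ) (t : ℝ) : ℝ := sSup {s : ℝ | depart μ A s ≤ t}

/-- The support of a nondecreasing function `F`: the closed set of its growth
points.  For an arrival profile this is the smallest closed set whose
`F`-(Stieltjes-)measure is the full mass. -/
def suppF (F : ℝ → ℝ) : Set ℝ := {t : ℝ | ∀ ε > 0, F (t - ε) < F (t + ε)}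

namespace HDS

/-- HDS: total arrival profile at queue 1. -/
def A1 (F1 F2 : ℝ → ℝ) : ℝ → ℝ := fun t => F1 t + F2 t

/-- HDS: departure time from queue 1. -/
def tau1 (μ1 : ℝ) (F1 F2 : ℝ → ℝ) : ℝ → ℝ := depart μ1 (A1 F1 F2)

/-- HDS: arrival profile at queue 2, `A2(t) = F2(τ1⁻¹(t))`. -/
def A2 (μ1 : ℝ) (F1 F2 : ℝ → ℝ) : ℝ → ℝ := fun t => F2 (departInv μ1 (A1 F1 F2) t)

/-- HDS: queue length at queue 1. -/
def Q1 (μ1 : ℝ) (F1 F2 : ℝ → ℝ) : ℝ → ℝ := queueLen μ1 (A1 F1 F2)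

/-- HDS: queue length at queue 2. -/
def Q2 (μ1 μ2 : ℝ) (F1 F2 : ℝ → ℝ) : ℝ → ℝ := queueLen μ2 (A2 μ1 F1 F2)

/-- HDS: waiting time at queue 1. -/
def W1 (μ1 : ℝ) (F1 F2 : ℝ → ℝ) : ℝ → ℝ := wait μ1 (A1 F1 F2)

/-- HDS: waiting time at queue 2. -/
def W2 (μ1 μ2 : ℝ) (F1 F2 : ℝ → ℝ) : ℝ → ℝ := wait μ2 (A2 μ1 F1 F2)

/-- HDS: network cost of a class-1 customer arriving at time `t`. -/
def cost1 (μ1 γ1 : ℝ) (F1 F2 : ℝ → ℝ) : ℝ → ℝ :=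
  fun t => γ1 * W1 μ1 F1 F2 t + (1 - γ1) * tau1 μ1 F1 F2 t

/-- HDS: network cost of a class-2 customer arriving at time `t`. -/
def cost2 (μ1 μ2 γ2 : ℝ) (F1 F2 : ℝ → ℝ) : ℝ → ℝ :=
  fun t =>
    γ2 * (W1 μ1 F1 F2 t + W2 μ1 μ2 F1 F2 (tau1 μ1 F1 F2 t))
      + (1 - γ2) * (tau1 μ1 F1 F2 t + W2 μ1 μ2 F1 F2 (tau1 μ1 F1 F2 t))

/-- Equilibrium arrival profile (EAP) of the Heterogeneous Departure System. -/
def IsEAP (μ1 μ2 γ1 γ2 Λ1 Λ2 : ℝ) (P1 : ArrivalProfile Λ1) (P2 : ArrivalProfile Λ2) :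
    Prop :=
  (∀ t ∈ suppF P1.F, ∀ s : ℝ, cost1 μ1 γ1 P1.F P2.F t ≤ cost1 μ1 γ1 P1.F P2.F s) ∧
  (∀ t ∈ suppF P2.F, ∀ s : ℝ,
    cost2 μ1 μ2 γ2 P1.F P2.F t ≤ cost2 μ1 μ2 γ2 P1.F P2.F s)

end HDS

namespace HAS

/-- HAS: departure time from queue 1. -/
def tau1 (μ1 : ℝ) (F1 : ℝ → ℝ) : ℝ → ℝ := depart μ1 F1

/-- HAS: arrival profile at queue 2, `A2(t) = F1(τ1⁻¹(t)) + F2(t)`. -/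
def A2 (μ1 : ℝ) (F1 F2 : ℝ → ℝ) : ℝ → ℝ := fun t => F1 (departInv μ1 F1 t) + F2 t

/-- HAS: queue length at queue 1. -/
def Q1 (μ1 : ℝ) (F1 : ℝ → ℝ) : ℝ → ℝ := queueLen μ1 F1

/-- HAS: queue length at queue 2. -/
def Q2 (μ1 μ2 : ℝ) (F1 F2 : ℝ → ℝ) : ℝ → ℝ := queueLen μ2 (A2 μ1 F1 F2)

/-- HAS: waiting time at queue 2. -/
def W2 (μ1 μ2 : ℝ) (F1 F2 : ℝ → ℝ) : ℝ → ℝ := wait μ2 (A2 μ1 F1 F2)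

/-- HAS: network cost of a class-1 customer arriving at time `t`. -/
def cost1 (μ1 μ2 γ1 : ℝ) (F1 F2 : ℝ → ℝ) : ℝ → ℝ :=
  fun t =>
    γ1 * (wait μ1 F1 t + W2 μ1 μ2 F1 F2 (tau1 μ1 F1 t))
      + (1 - γ1) * (tau1 μ1 F1 t + W2 μ1 μ2 F1 F2 (tau1 μ1 F1 t))

/-- HAS: network cost of a class-2 customer arriving at time `t`. -/
def cost2 (μ1 μ2 γ2 : ℝ) (F1 F2 : ℝ → ℝ) : ℝ → ℝ :=
  fun t => γ2 * W2 μ1 μ2 F1 F2 t + (1 - γ2) * depart μ2 (A2 μ1 F1 F2) t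

/-- Equilibrium arrival profile (EAP) of the Heterogeneous Arrival System. -/
def IsEAP (μ1 μ2 γ1 γ2 Λ1 Λ2 : ℝ) (P1 : ArrivalProfile Λ1) (P2 : ArrivalProfile Λ2) :
    Prop :=
  (∀ t ∈ suppF P1.F, ∀ s : ℝ, cost1 μ1 μ2 γ1 P1.F P2.F t ≤ cost1 μ1 μ2 γ1 P1.F P2.F s) ∧
  (∀ t ∈ suppF P2.F, ∀ s : ℝ,
    cost2 μ1 μ2 γ2 P1.F P2.F t ≤ cost2 μ1 μ2 γ2 P1.F P2.F s)

end HAS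

/-- Piecewise-linear ramp: increases at rate `r` on `[a, b]`, constant (`0` before
`a`, `r·(b−a)` after `b`) outside. -/
def ramp (r a b : ℝ) : ℝ → ℝ := fun t => r * max 0 (min t b - a)

/-- Case-1 support boundary `T_{1,a}`. -/
def s8T1a (μ1 μ2 γ1 γ2 Λ1 Λ2 : ℝ) : ℝ :=
  -(1 / γ1 - 1) * (Λ1 / μ1) - (1 / γ2 - 1) * (Λ2 / μ2)

/-- Case-1 support boundary `T_{1,f} = T_{2,a}`. -/
def s8T1f (μ1 μ2 γ1 γ2 Λ1 Λ2 : ℝ) : ℝ := Λ1 / μ1 - (1 / γ2 - 1) * (Λ2 / μ2)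

/-- Case-1 support boundary `T_{2,f}`. -/
def s8T2f (μ1 μ2 γ1 γ2 Λ1 Λ2 : ℝ) : ℝ := Λ1 / μ1 + Λ2 / μ2

/-- Running supremum of `max (μ s - A s) 0` over `[0, t]`: the service capacity lost to
idleness up to time `t`. -/
def idle (μ : ℝ) (A : ℝ → ℝ) (t : ℝ) : ℝ :=
  sSup ((fun s => max (μ * s - A s) 0) '' Set.Icc 0 t)

/-- A nonnegative queue input which is nondecreasing at positive times. -/
structure IsInput (A : ℝ → ℝ) : Prop where
  nonneg : ∀ t, 0 ≤ A t
  mono : MonotoneOn A (Ioi 0)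

/-- A cumulative profile starting from `0` at `-∞`. -/
structure IsCumulative (A : ℝ → ℝ) : Prop where
  mono : Monotone A
  right : ∀ t, ContinuousWithinAt A (Ici t) t
  bot : Tendsto A atBot (nhds 0)

lemma IsCumulative.nonneg {A : ℝ → ℝ} (h : IsCumulative A) (t : ℝ) : 0 ≤ A t :=
  h.mono.le_of_tendsto h.bot t

lemma IsCumulative.isInput {A : ℝ → ℝ} (h : IsCumulative A) : IsInput A :=
  ⟨h.nonneg, h.mono.monotoneOn _⟩

lemma IsCumulative.add {A B : ℝ → ℝ} (hA : IsCumulative A) (hB : IsCumulative B) :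
    IsCumulative (fun t => A t + B t) :=
  ⟨hA.mono.add hB.mono, fun t => (hA.right t).add (hB.right t),
    by simpa using hA.bot.add hB.bot⟩

lemma ArrivalProfile.isCumulative {Λ : ℝ} (P : ArrivalProfile Λ) : IsCumulative P.F :=
  ⟨P.mono, P.rightCont, P.tendsto_bot⟩

section Idle

variable {μ : ℝ} {A : ℝ → ℝ}

lemma idle_bddAbove (hμ : 0 < μ) (hA : ∀ t, 0 ≤ A t) (t : ℝ) :
    BddAbove ((fun s => max (μ * s - A s) 0) '' Set.Icc 0 t) := by
  refine ⟨μ * max t 0, ?_⟩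
  rintro _ ⟨s, hs, rfl⟩
  have h1 : s ≤ max t 0 := hs.2.trans (le_max_left _ _)
  have h2 := mul_le_mul_of_nonneg_left h1 hμ.le
  have h3 := hA s
  have h4 : 0 ≤ μ * max t 0 := by positivity
  exact max_le (by linarith) h4

lemma idle_nonneg (μ : ℝ) (A : ℝ → ℝ) (t : ℝ) : 0 ≤ idle μ A t := by
  apply Real.sSup_nonneg
  rintro _ ⟨s, -, rfl⟩
  exact le_max_right _ _

lemma le_idle (hμ : 0 < μ) (hA : ∀ t, 0 ≤ A t) {s t : ℝ} (hs : 0 ≤ s) (hst : s ≤ t) :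
    μ * s - A s ≤ idle μ A t :=
  (le_max_left _ _).trans (le_csSup (idle_bddAbove hμ hA t) ⟨s, ⟨hs, hst⟩, rfl⟩)

lemma idle_le {B t : ℝ} (hB : 0 ≤ B) (h : ∀ s, 0 ≤ s → s ≤ t → μ * s - A s ≤ B) :
    idle μ A t ≤ B := by
  apply Real.sSup_le _ hB
  rintro _ ⟨s, hs, rfl⟩
  exact max_le (h s hs.1 hs.2) hB

lemma idle_mono (hμ : 0 < μ) (hA : ∀ t, 0 ≤ A t) : Monotone (idle μ A) := fun _ _ h =>
  idle_le (idle_nonneg _ _ _) fun _ h0 hr => le_idle hμ hA h0 (hr.trans h)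

lemma idle_le_mul (hμ : 0 < μ) (hA : ∀ t, 0 ≤ A t) {t : ℝ} (ht : 0 ≤ t) :
    idle μ A t ≤ μ * t :=
  idle_le (by positivity) fun s _ hs => by
    have := mul_le_mul_of_nonneg_left hs hμ.le
    linarith [hA s]

lemma idle_of_nonpos (hA : ∀ t, 0 ≤ A t) {t : ℝ} (ht : t ≤ 0) : idle μ A t = 0 := by
  refine le_antisymm (idle_le le_rfl fun s h0 hs => ?_) (idle_nonneg _ _ _)
  have : s = 0 := by linarith
  subst this
  linarith [hA 0]

lemma idle_le_add (hμ : 0 < μ) (hA : IsInput A) {s t : ℝ} (hst : s ≤ t) :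
    idle μ A t ≤ idle μ A s + μ * (t - s) := by
  have hn := idle_nonneg μ A s
  have hd : 0 ≤ μ * (t - s) := mul_nonneg hμ.le (by linarith)
  refine idle_le (by linarith) fun r h0 hr => ?_
  have hm : μ * r ≤ μ * t := mul_le_mul_of_nonneg_left hr hμ.le
  rcases le_total r s with h | h
  · linarith [le_idle hμ hA.nonneg h0 h]
  · rcases le_or_gt s 0 with h' | h'
    · have : 0 ≤ μ * (-s) := mul_nonneg hμ.le (by linarith)
      linarith [hA.nonneg r]
    · have h1 := hA.mono (mem_Ioi.2 h') (mem_Ioi.2 (h'.trans_le h)) h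
      have h2 := le_idle hμ hA.nonneg h'.le le_rfl
      linarith

lemma continuous_idle (hμ : 0 < μ) (hA : IsInput A) : Continuous (idle μ A) := by
  have : LipschitzWith ⟨μ, hμ.le⟩ (idle μ A) := by
    refine LipschitzWith.of_le_add_mul _ fun x y => ?_
    have h0 : 0 ≤ μ * dist x y := mul_nonneg hμ.le dist_nonneg
    rcases le_total x y with h | h
    · exact (idle_mono hμ hA.nonneg h).trans (le_add_of_nonneg_right h0)
    · have := idle_le_add hμ hA h
      rw [Real.dist_eq, abs_of_nonneg (by linarith)]
      exact this
  exact this.continuous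

lemma queueLen_nonneg (hμ : 0 < μ) (hA : ∀ t, 0 ≤ A t) (t : ℝ) : 0 ≤ queueLen μ A t := by
  change 0 ≤ A t - μ * max t 0 + idle μ A t
  rcases le_total t 0 with h | h
  · rw [max_eq_right h]
    linarith [hA t, idle_nonneg μ A t]
  · rw [max_eq_left h]
    linarith [le_idle hμ hA h le_rfl]

lemma leftLim_nonneg {f : ℝ → ℝ} (hf : ∀ t, 0 ≤ f t) (a : ℝ) : 0 ≤ Function.leftLim f a := by
  by_cases h : ∃ y, Tendsto f (nhdsWithin a (Iio a)) (nhds y)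
  · obtain ⟨y, hy⟩ := h
    rw [leftLim_eq_of_tendsto hy]
    exact ge_of_tendsto' hy hf
  · rw [leftLim_eq_of_not_tendsto f h]
    exact hf a

lemma rightLim_nonneg {f : ℝ → ℝ} (hf : ∀ t, 0 ≤ f t) (a : ℝ) : 0 ≤ Function.rightLim f a := by
  by_cases h : ∃ y, Tendsto f (nhdsWithin a (Ioi a)) (nhds y)
  · obtain ⟨y, hy⟩ := h
    rw [rightLim_eq_of_tendsto hy]
    exact ge_of_tendsto' hy hf
  · rw [rightLim_eq_of_not_tendsto f h]
    exact hf a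

lemma wait_ge (hμ : 0 < μ) (hA : ∀ t, 0 ≤ A t) (t : ℝ) : max 0 (-t) ≤ wait μ A t := by
  have h1 := leftLim_nonneg (queueLen_nonneg hμ hA) t
  have h2 := rightLim_nonneg (queueLen_nonneg hμ hA) t
  have : 0 ≤ (Function.rightLim (queueLen μ A) t + Function.leftLim (queueLen μ A) t) /
    (2 * μ) := by positivity
  simp only [wait]
  linarith

lemma le_depart (hμ : 0 < μ) (hA : ∀ t, 0 ≤ A t) (t : ℝ) : t ≤ depart μ A t := by
  have := (le_max_left _ _).trans (wait_ge hμ hA t)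
  simp only [depart]
  linarith

lemma depart_nonneg (hμ : 0 < μ) (hA : ∀ t, 0 ≤ A t) (t : ℝ) : 0 ≤ depart μ A t := by
  have := (le_max_right _ _).trans (wait_ge hμ hA t)
  simp only [depart]
  linarith

lemma depart_eq (hμ : 0 < μ) (hA : IsInput A) {t L : ℝ}
    (hL : Tendsto A (nhdsWithin t (Iio t)) (nhds L))
    (hR : ContinuousWithinAt A (Ici t) t) :
    μ * depart μ A t = (L + A t) / 2 + idle μ A t := by
  have hc : Continuous fun s => - (μ * max s 0) + idle μ A s :=
    (by fun_prop : Continuous fun s : ℝ => - (μ * max s 0)).add (continuous_idle hμ hA)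
  have hl : Function.leftLim (queueLen μ A) t = L + (- (μ * max t 0) + idle μ A t) := by
    apply leftLim_eq_of_tendsto
    refine (hL.add ((hc.tendsto t).mono_left nhdsWithin_le_nhds)).congr fun s => ?_
    change _ = A s - μ * max s 0 + idle μ A s
    ring
  have hr : Function.rightLim (queueLen μ A) t = A t + (- (μ * max t 0) + idle μ A t) := by
    apply rightLim_eq_of_tendsto
    have hR' : Tendsto A (nhdsWithin t (Ioi t)) (nhds (A t)) :=
      hR.tendsto.mono_left (nhdsWithin_mono _ Ioi_subset_Ici_self)
    refine (hR'.add ((hc.tendsto t).mono_left nhdsWithin_le_nhds)).congr fun s => ?_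
    change _ = A s - μ * max s 0 + idle μ A s
    ring
  have hm : max 0 (-t) = max t 0 - t := by
    rcases le_total t 0 with h | h
    · rw [max_eq_right h, max_eq_right (by linarith)]; ring
    · rw [max_eq_left h, max_eq_left (by linarith)]; ring
  simp only [depart, wait, hl, hr, hm]
  field_simp
  ring

lemma IsInput.exists_left_tendsto (hA : IsInput A) {t : ℝ} (ht : 0 < t) :
    ∃ L, Tendsto A (nhdsWithin t (Iio t)) (nhds L) := by
  have hm : Monotone fun s => if s ≤ 0 then 0 else A s := by
    intro a b hab
    by_cases ha : a ≤ 0 <;> by_cases hb : b ≤ 0 <;> simp only [ha, hb, if_true, if_false]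
    · exact le_rfl
    · exact hA.nonneg _
    · exact absurd (hab.trans hb) ha
    · exact hA.mono (mem_Ioi.2 (not_le.1 ha)) (mem_Ioi.2 (not_le.1 hb)) hab
  refine ⟨_, (hm.tendsto_leftLim t).congr' ?_⟩
  have : ∀ᶠ s in nhdsWithin t (Iio t), 0 < s :=
    nhdsWithin_le_nhds (lt_mem_nhds ht)
  filter_upwards [this] with s hs
  simp [not_le.2 hs]

lemma depart_le_of_lt (hμ : 0 < μ) (hA : IsInput A) {t l : ℝ} (ht : 0 < t)
    (hR : ContinuousWithinAt A (Ici t) t) (h : ∀ s, 0 < s → s < t → A s ≤ l) :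
    μ * depart μ A t ≤ (l + A t) / 2 + idle μ A t := by
  obtain ⟨L, hL⟩ := hA.exists_left_tendsto ht
  rw [depart_eq hμ hA hL hR]
  have : L ≤ l := by
    refine le_of_tendsto hL ?_
    filter_upwards [nhdsWithin_le_nhds (lt_mem_nhds ht), self_mem_nhdsWithin] with s h0 h1
    exact h s h0 h1
  linarith

lemma depart_le (hμ : 0 < μ) (hA : IsInput A) {t : ℝ} (ht : 0 < t)
    (hR : ContinuousWithinAt A (Ici t) t) :
    μ * depart μ A t ≤ A t + idle μ A t := by
  have := depart_le_of_lt hμ hA ht hR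
    fun s h0 h => hA.mono (mem_Ioi.2 h0) (mem_Ioi.2 ht) h.le
  linarith

lemma le_depart_of_lt (hμ : 0 < μ) (hA : IsInput A) {s₀ t B : ℝ} (h₀ : 0 ≤ s₀) (ht : s₀ < t)
    (hR : ContinuousWithinAt A (Ici t) t) (h : ∀ s, s₀ < s → s < t → B ≤ A s) :
    B + idle μ A t ≤ μ * depart μ A t := by
  have ht0 := h₀.trans_lt ht
  obtain ⟨L, hL⟩ := hA.exists_left_tendsto ht0
  rw [depart_eq hμ hA hL hR]
  have h1 : B ≤ L := by
    refine ge_of_tendsto hL ?_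
    filter_upwards [nhdsWithin_le_nhds (lt_mem_nhds ht), self_mem_nhdsWithin] with s h0 h1
    exact h s h0 h1
  have h2 : B ≤ A t := by
    obtain ⟨s, hs, hst⟩ := exists_between ht
    exact (h s hs hst).trans (hA.mono (mem_Ioi.2 (h₀.trans_lt hs)) (mem_Ioi.2 ht0) hst.le)
  linarith

end Idle

section Cumulative

variable {μ : ℝ} {A : ℝ → ℝ}

lemma IsCumulative.le_of_forall_gt (h : IsCumulative A) {t y : ℝ} (hy : ∀ r, t < r → y ≤ A r) :
    y ≤ A t := by
  have : Tendsto A (nhdsWithin t (Ioi t)) (nhds (A t)) :=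
    (h.right t).tendsto.mono_left (nhdsWithin_mono _ Ioi_subset_Ici_self)
  refine ge_of_tendsto this ?_
  filter_upwards [self_mem_nhdsWithin] with r hr using hy r hr

lemma IsCumulative.leftLim_le_of_forall_lt (h : IsCumulative A) {t y : ℝ}
    (hy : ∀ r, r < t → A r ≤ y) : Function.leftLim A t ≤ y := by
  refine le_of_tendsto (h.mono.tendsto_leftLim t) ?_
  filter_upwards [self_mem_nhdsWithin] with r hr using hy r hr

lemma IsCumulative.leftLim_add {B : ℝ → ℝ} (hA : IsCumulative A) (hB : IsCumulative B) (t : ℝ) :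
    Function.leftLim (fun t => A t + B t) t = Function.leftLim A t + Function.leftLim B t :=
  leftLim_eq_of_tendsto ((hA.mono.tendsto_leftLim t).add (hB.mono.tendsto_leftLim t))

lemma IsCumulative.mul_depart (hμ : 0 < μ) (h : IsCumulative A) (t : ℝ) :
    μ * depart μ A t = (Function.leftLim A t + A t) / 2 + idle μ A t :=
  depart_eq hμ h.isInput (h.mono.tendsto_leftLim t) (h.right t)

lemma IsCumulative.mul_depart_le (hμ : 0 < μ) (h : IsCumulative A) (t : ℝ) :
    μ * depart μ A t ≤ A t + idle μ A t := by
  rw [h.mul_depart hμ]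
  linarith [h.mono.leftLim_le (le_refl t)]

lemma IsCumulative.le_mul_depart (hμ : 0 < μ) (h : IsCumulative A) {s t : ℝ} (hst : s < t) :
    (A s + A t) / 2 + idle μ A t ≤ μ * depart μ A t := by
  rw [h.mul_depart hμ]
  linarith [h.mono.le_leftLim hst]

lemma IsCumulative.depart_mono (hμ : 0 < μ) (h : IsCumulative A) : Monotone (depart μ A) := by
  intro s t hst
  rcases hst.eq_or_lt with rfl | hst
  · exact le_rfl
  · have h1 := h.mul_depart_le hμ s
    have h2 := h.le_mul_depart hμ hst
    have h3 := idle_mono hμ h.nonneg hst.le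
    have h4 := h.mono hst.le
    exact le_of_mul_le_mul_left (by linarith) hμ

lemma IsCumulative.leftLim_add_idle_le (hμ : 0 < μ) (h : IsCumulative A) {t K : ℝ}
    (hK : ∀ r, r < t → μ * depart μ A r ≤ K) : Function.leftLim A t + idle μ A t ≤ K := by
  have hc := (continuous_idle hμ h.isInput).tendsto t
  have ht : Tendsto (fun r => A r + idle μ A r) (nhdsWithin t (Iio t))
      (nhds (Function.leftLim A t + idle μ A t)) :=
    (h.mono.tendsto_leftLim t).add (hc.mono_left nhdsWithin_le_nhds)
  refine le_of_tendsto ht ?_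
  filter_upwards [self_mem_nhdsWithin] with r hr
  obtain ⟨q, hq, hqt⟩ := exists_between (show r < t from hr)
  have h2 := h.le_mul_depart hμ hq
  have h3 := idle_mono hμ h.nonneg hq.le
  have h4 := h.mono hq.le
  linarith [hK q hqt]

lemma IsCumulative.mul_depart_le_leftLim (hμ : 0 < μ) (h : IsCumulative A) {s t : ℝ}
    (hst : s < t) : μ * depart μ A s ≤ Function.leftLim A t + idle μ A t := by
  linarith [h.mul_depart_le hμ s, h.mono.le_leftLim hst, idle_mono hμ h.nonneg hst.le]

lemma IsCumulative.le_leftLim_add_idle (hμ : 0 < μ) (h : IsCumulative A) {t : ℝ} :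
    μ * t ≤ Function.leftLim A t + idle μ A t := by
  have : ∀ s < t, s ≤ (Function.leftLim A t + idle μ A t) / μ := fun s hs => by
    rw [le_div_iff₀ hμ]
    have := mul_le_mul_of_nonneg_left (le_depart hμ h.nonneg s) hμ.le
    linarith [h.mul_depart_le_leftLim hμ hs]
  have := le_of_forall_lt_imp_le_of_dense this
  rw [le_div_iff₀ hμ] at this
  linarith

/-- If every departure time dominates a line of slope `γ < 1`, the server never idles before that
line meets the diagonal. -/
lemma IsCumulative.idle_eq_zero (hμ : 0 < μ) (h : IsCumulative A) {γ c t : ℝ} (hγ : γ < 1)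
    (hc : ∀ r, γ * r + c ≤ depart μ A r) (ht : t ≤ γ * t + c) : idle μ A t = 0 := by
  have key : ∀ s, s < t → idle μ A s = 0 := by
    intro s hs
    by_contra hne
    have hpos : 0 < idle μ A s := lt_of_le_of_ne (idle_nonneg _ _ _) (Ne.symm hne)
    have hη : 0 < c - (1 - γ) * s := by nlinarith
    have : idle μ A s ≤ max (idle μ A s - μ * (c - (1 - γ) * s)) 0 := by
      refine idle_le (le_max_right _ _) fun r h0 hr => le_trans ?_ (le_max_left _ _)
      have h1 := h.mul_depart_le hμ r
      have h2 := mul_le_mul_of_nonneg_left (hc r) hμ.le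
      have h3 := idle_mono hμ h.nonneg hr
      have h4 : 0 ≤ μ * ((1 - γ) * (s - r)) :=
        mul_nonneg hμ.le (mul_nonneg (by linarith) (by linarith))
      nlinarith
    have h5 : 0 < μ * (c - (1 - γ) * s) := mul_pos hμ hη
    exact absurd this (not_le.2 (max_lt (by linarith) hpos))
  refine tendsto_nhds_unique
    (((continuous_idle hμ h.isInput).tendsto t).mono_left nhdsWithin_le_nhds)
    (Tendsto.congr' ?_ (tendsto_const_nhds (x := (0 : ℝ)) (f := nhdsWithin t (Iio t))))
  filter_upwards [self_mem_nhdsWithin] with s hs using (key s hs).symm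

/-- With no arrivals on `(s, t]`, an arrival at `t` leaves no later than `max (τ s) t`, where `τ s`
counts all the work present at `s`. -/
lemma IsCumulative.mul_depart_le_of_const (hμ : 0 < μ) (h : IsCumulative A) {s t : ℝ}
    (hc : A t = A s) :
    μ * depart μ A t ≤ max (A s + idle μ A s) (μ * t) := by
  refine (h.mul_depart_le hμ t).trans ?_
  have hs0 := idle_nonneg μ A s
  have : idle μ A t ≤ max (idle μ A s) (μ * t - A s) := by
    refine idle_le (le_max_of_le_left hs0) fun r h0 hr => ?_
    rcases le_total r s with hrs | hrs
    · exact le_max_of_le_left (le_idle hμ h.nonneg h0 hrs)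
    · have h1 := h.mono hrs
      have h2 := mul_le_mul_of_nonneg_left hr hμ.le
      exact le_max_of_le_right (by linarith)
  rw [hc]
  rcases le_total (idle μ A s) (μ * t - A s) with h' | h'
  · rw [max_eq_right h'] at this
    exact le_max_of_le_right (by linarith)
  · rw [max_eq_left h'] at this
    exact le_max_of_le_left (by linarith)

end Cumulative

section Support

variable {F : ℝ → ℝ}

lemma IsCumulative.exists_last_le (h : IsCumulative F) {y : ℝ} (h₀ : ∃ t, F t ≤ y)
    (h₁ : ∃ t, y < F t) :
    ∃ t ∈ suppF F, (∀ r < t, F r ≤ y) ∧ ∀ r, t < r → y < F r := by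
  obtain ⟨t₁, ht₁⟩ := h₁
  have hb : BddAbove {s | F s ≤ y} :=
    ⟨t₁, fun s hs => le_of_not_gt fun hlt => (hs.trans_lt ht₁).not_ge (h.mono hlt.le)⟩
  have hl : ∀ r < sSup {s | F s ≤ y}, F r ≤ y := fun r hr => by
    obtain ⟨s, hs, hrs⟩ := exists_lt_of_lt_csSup h₀ hr
    exact (h.mono hrs.le).trans hs
  have hr : ∀ r, sSup {s | F s ≤ y} < r → y < F r := fun r hr =>
    not_le.1 fun hle => (le_csSup hb hle).not_gt hr
  exact ⟨_, fun ε hε => (hl _ (by linarith)).trans_lt (hr _ (by linarith)), hl, hr⟩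

lemma IsCumulative.exists_first_ge (h : IsCumulative F) {y : ℝ} (h₀ : ∃ t, y ≤ F t)
    (h₁ : ∃ t, F t < y) :
    ∃ t ∈ suppF F, (∀ r < t, F r < y) ∧ y ≤ F t := by
  obtain ⟨t₁, ht₁⟩ := h₁
  have hb : BddBelow {s | y ≤ F s} :=
    ⟨t₁, fun s hs => le_of_not_gt fun hlt => (ht₁.trans_le hs).not_ge (h.mono hlt.le)⟩
  have hr : ∀ r, sInf {s | y ≤ F s} < r → y ≤ F r := fun r hr => by
    obtain ⟨s, hs, hrs⟩ := exists_lt_of_csInf_lt h₀ hr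
    exact (show y ≤ F s from hs).trans (h.mono hrs.le)
  have hl : ∀ r < sInf {s | y ≤ F s}, F r < y := fun r hr =>
    not_le.1 fun hle => (csInf_le hb hle).not_gt hr
  exact ⟨_, fun ε hε => (hl _ (by linarith)).trans_le (hr _ (by linarith)), hl,
    h.le_of_forall_gt hr⟩

lemma mem_suppF_of_leftLim_lt (h : IsCumulative F) {t : ℝ} (ht : Function.leftLim F t < F t) :
    t ∈ suppF F := fun ε hε =>
  (h.mono.le_leftLim (by linarith)).trans_lt (ht.trans_le (h.mono (by linarith)))

lemma le_of_mem_suppF (h : IsCumulative F) {b t Λ : ℝ} (hΛ : ∀ s, F s ≤ Λ) (hb : F b = Λ)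
    (ht : t ∈ suppF F) : t ≤ b := by
  by_contra hlt
  have := ht (t - b) (by linarith)
  rw [show t - (t - b) = b by ring, hb] at this
  exact this.not_ge (hΛ _)

lemma ge_of_mem_suppF {b t : ℝ} (h : IsCumulative F) (hb : ∀ s < b, F s = 0)
    (ht : t ∈ suppF F) : b ≤ t := by
  by_contra hlt
  have := ht ((b - t) / 2) (by linarith)
  rw [hb (t + (b - t) / 2) (by linarith)] at this
  exact this.not_ge (h.nonneg _)

/-- A continuous profile which agrees on its support with an increasing line is the
ramp cut out of that line. -/
lemma IsCumulative.eq_ramp (h : IsCumulative F) {Λ r a f : ℝ}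
    (hF : ∀ t, F t ≤ Λ) (hΛ : Λ = r * (f - a)) (hr : 0 < r) (hf : a ≤ f)
    (hbot : ∃ t, F t ≤ 0) (htop : Tendsto F atTop (nhds Λ))
    (hcont : ∀ t, F t ≤ Function.leftLim F t)
    (hline : ∀ t ∈ suppF F, F t = r * (t - a)) : F = ramp r a f := by
  have hpos : ∀ t, 0 < F t → F t ≤ r * (t - a) := fun t ht => by
    obtain ⟨s, hs, hl, hge⟩ := h.exists_first_ge ⟨t, le_refl (F t)⟩
      (hbot.imp fun _ h' => h'.trans_lt ht)
    have hst : s ≤ t := le_of_not_gt fun hlt => (hl t hlt).ne rfl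
    have : F s ≤ F t := h.mono hst
    rw [← le_antisymm this hge, hline s hs]
    exact mul_le_mul_of_nonneg_left (by linarith) hr.le
  have hlt : ∀ t, F t < Λ → r * (t - a) ≤ F t := fun t ht => by
    obtain ⟨s, hs, hl, hgt⟩ := h.exists_last_le ⟨t, le_refl (F t)⟩
      (htop.eventually (lt_mem_nhds ht)).exists
    have hst : t ≤ s := le_of_not_gt fun hlt => (hgt t hlt).ne rfl
    have h1 : F s ≤ F t := (hcont s).trans (h.leftLim_le_of_forall_lt hl)
    rw [hline s hs] at h1
    exact (mul_le_mul_of_nonneg_left (by linarith) hr.le).trans h1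
  funext t
  simp only [ramp]
  have h0 := h.nonneg t
  have h1 := hF t
  rcases le_total t a with hta | hta
  · have hm : max 0 (min t f - a) = 0 :=
      max_eq_left (by linarith [min_le_left t f])
    rw [hm, mul_zero]
    by_contra hne
    have := hpos t (lt_of_le_of_ne h0 (Ne.symm hne))
    have : r * (t - a) ≤ 0 := mul_nonpos_of_nonneg_of_nonpos hr.le (by linarith)
    exact hne (by linarith)
  rcases le_total t f with htf | htf
  · rw [min_eq_left htf, max_eq_right (by linarith)]
    rcases h0.eq_or_lt with hz | hz
    · rcases h1.eq_or_lt with hz' | hz'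
      · have : r * (t - a) ≤ r * (f - a) := mul_le_mul_of_nonneg_left (by linarith) hr.le
        have : 0 ≤ r * (t - a) := mul_nonneg hr.le (by linarith)
        linarith
      · have := hlt t hz'
        have : 0 ≤ r * (t - a) := mul_nonneg hr.le (by linarith)
        linarith
    · rcases h1.eq_or_lt with hz' | hz'
      · have : r * (t - a) ≤ r * (f - a) := mul_le_mul_of_nonneg_left (by linarith) hr.le
        linarith [hpos t hz]
      · exact le_antisymm (hpos t hz) (hlt t hz')
  · rw [min_eq_right htf, max_eq_right (by linarith), ← hΛ]
    by_contra hne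
    have := hlt t (lt_of_le_of_ne h1 hne)
    have : r * (f - a) ≤ r * (t - a) := mul_le_mul_of_nonneg_left (by linarith) hr.le
    exact hne (by linarith)

end Support

section DepartInv

variable {μ : ℝ} {A : ℝ → ℝ}

lemma departInv_bddAbove (hμ : 0 < μ) (hA : ∀ t, 0 ≤ A t) (x : ℝ) :
    BddAbove {s : ℝ | depart μ A s ≤ x} :=
  ⟨x, fun s hs => (le_depart hμ hA s).trans hs⟩

lemma le_departInv (hμ : 0 < μ) (hA : ∀ t, 0 ≤ A t) {t x : ℝ} (h : depart μ A t ≤ x) :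
    t ≤ departInv μ A x :=
  le_csSup (departInv_bddAbove hμ hA x) h

lemma IsCumulative.exists_depart_le (hμ : 0 < μ) (h : IsCumulative A) {x : ℝ} (hx : 0 < x) :
    ∃ s, depart μ A s ≤ x := by
  have h1 : ∀ᶠ s in atBot, A s < μ * x :=
    h.bot.eventually (gt_mem_nhds (by positivity))
  obtain ⟨s, hs, hs0⟩ := (h1.and (eventually_le_atBot 0)).exists
  refine ⟨s, le_of_mul_le_mul_left ?_ hμ⟩
  have := h.mul_depart_le hμ s
  rw [idle_of_nonpos h.nonneg hs0] at this
  linarith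

lemma IsCumulative.departInv_le_of_forall (hμ : 0 < μ) (h : IsCumulative A) {t x : ℝ} (hx : 0 < x)
    (ht : ∀ s, depart μ A s ≤ x → s ≤ t) : departInv μ A x ≤ t :=
  csSup_le (h.exists_depart_le hμ hx) ht

lemma IsCumulative.departInv_le (hμ : 0 < μ) (h : IsCumulative A) {t x : ℝ} (hx : 0 < x)
    (ht : x < depart μ A t) : departInv μ A x ≤ t :=
  h.departInv_le_of_forall hμ hx fun s hs =>
    le_of_not_gt fun hlt => (hs.trans_lt ht).not_ge (h.depart_mono hμ hlt.le)

lemma IsCumulative.departInv_le_self (hμ : 0 < μ) (h : IsCumulative A) {x : ℝ} (hx : 0 < x) :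
    departInv μ A x ≤ x :=
  h.departInv_le_of_forall hμ hx fun s hs => (le_depart hμ h.nonneg s).trans hs

lemma IsCumulative.departInv_mono (hμ : 0 < μ) (h : IsCumulative A) :
    MonotoneOn (departInv μ A) (Ioi 0) := fun x hx y _ hxy =>
  h.departInv_le_of_forall hμ (mem_Ioi.1 hx) fun _ hs =>
    le_departInv hμ h.nonneg (hs.trans hxy)

lemma IsCumulative.lt_depart_of_departInv_lt (hμ : 0 < μ) (h : IsCumulative A) {x r : ℝ}
    (hr : departInv μ A x < r) : x < depart μ A r :=
  not_le.1 fun hle => (le_departInv hμ h.nonneg hle).not_gt hr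

lemma IsCumulative.mul_le_at_departInv (hμ : 0 < μ) (h : IsCumulative A) (x : ℝ) :
    μ * x ≤ A (departInv μ A x) + idle μ A (departInv μ A x) := by
  have hc := (continuous_idle hμ h.isInput).tendsto (departInv μ A x)
  have hR : Tendsto A (nhdsWithin (departInv μ A x) (Ioi (departInv μ A x)))
      (nhds (A (departInv μ A x))) :=
    (h.right _).tendsto.mono_left (nhdsWithin_mono _ Ioi_subset_Ici_self)
  refine ge_of_tendsto (hR.add (hc.mono_left nhdsWithin_le_nhds)) ?_
  filter_upwards [self_mem_nhdsWithin] with r hr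
  have h1 := mul_le_mul_of_nonneg_left (h.lt_depart_of_departInv_lt hμ hr).le hμ.le
  linarith [h.mul_depart_le hμ r]

end DepartInv

section Network

variable {μ₁ : ℝ} {F₁ F₂ : ℝ → ℝ}

open HDS

lemma isCumulative_A1 (h₁ : IsCumulative F₁) (h₂ : IsCumulative F₂) :
    IsCumulative (A1 F₁ F₂) := h₁.add h₂

lemma isInput_A2 (hμ : 0 < μ₁) (h₁ : IsCumulative F₁) (h₂ : IsCumulative F₂) :
    IsInput (A2 μ₁ F₁ F₂) :=
  ⟨fun _ => h₂.nonneg _, fun _ hx _ hy hxy =>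
    h₂.mono ((isCumulative_A1 h₁ h₂).departInv_mono hμ hx hy hxy)⟩

lemma right_A2 (hμ : 0 < μ₁) (h₁ : IsCumulative F₁) (h₂ : IsCumulative F₂) {x : ℝ}
    (hx : 0 < x) : ContinuousWithinAt (A2 μ₁ F₁ F₂) (Ici x) x := by
  have hA := isCumulative_A1 h₁ h₂
  have hcw : ContinuousWithinAt (departInv μ₁ (A1 F₁ F₂)) (Ici x) x := by
    rw [Metric.continuousWithinAt_iff]
    intro ε hε
    have h1 : x < depart μ₁ (A1 F₁ F₂) (departInv μ₁ (A1 F₁ F₂) x + ε / 2) :=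
      hA.lt_depart_of_departInv_lt hμ (by linarith)
    refine ⟨_, sub_pos.2 h1, fun {y} hy hd => ?_⟩
    have hxy : x ≤ y := hy
    rw [Real.dist_eq, abs_of_nonneg (by linarith)] at hd
    have h2 := hA.departInv_le hμ (hx.trans_le hxy) (by linarith : y < _)
    have h3 := hA.departInv_mono hμ (mem_Ioi.2 hx) (mem_Ioi.2 (hx.trans_le hxy)) hxy
    rw [Real.dist_eq, abs_of_nonneg (by linarith)]
    linarith
  exact ContinuousWithinAt.comp (h₂.right _) hcw fun y hy =>
    hA.departInv_mono hμ (mem_Ioi.2 hx) (mem_Ioi.2 (hx.trans_le hy)) hy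

lemma cost1_eq (γ : ℝ) (t : ℝ) :
    cost1 μ₁ γ F₁ F₂ t = depart μ₁ (A1 F₁ F₂) t - γ * t := by
  simp only [cost1, W1, tau1, depart]
  ring

lemma cost2_eq (μ₂ γ : ℝ) (t : ℝ) :
    cost2 μ₁ μ₂ γ F₁ F₂ t =
      depart μ₂ (A2 μ₁ F₁ F₂) (depart μ₁ (A1 F₁ F₂) t) - γ * t := by
  simp only [cost2, W1, W2, tau1, depart]
  ring

end Network

/-- The equilibrium conditions in normalized form: departure times dominate the isocost lines,
with equality on the supports, and class 2 starts arriving at time `b`. -/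
structure HDS.Balance (μ₁ μ₂ γ₁ γ₂ Λ₁ Λ₂ : ℝ) (F₁ F₂ : ℝ → ℝ) (c₁ c₂ b : ℝ) : Prop where
  μ₁_pos : 0 < μ₁
  μ₂_pos : 0 < μ₂
  μ_lt : μ₂ < μ₁
  γ₁_pos : 0 < γ₁
  γ₁_lt : γ₁ < 1
  γ₂_pos : 0 < γ₂
  γ₂_lt : γ₂ < 1
  rate_le : μ₁ * γ₁ ≤ μ₂ * γ₂
  Λ₁_pos : 0 < Λ₁
  Λ₂_pos : 0 < Λ₂
  cum₁ : IsCumulative F₁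
  cum₂ : IsCumulative F₂
  le₁ : ∀ t, F₁ t ≤ Λ₁
  le₂ : ∀ t, F₂ t ≤ Λ₂
  top₁ : Tendsto F₁ atTop (nhds Λ₁)
  top₂ : Tendsto F₂ atTop (nhds Λ₂)
  depart₁_ge : ∀ t, γ₁ * t + c₁ ≤ depart μ₁ (HDS.A1 F₁ F₂) t
  depart₁_eq : ∀ t ∈ suppF F₁, depart μ₁ (HDS.A1 F₁ F₂) t = γ₁ * t + c₁
  depart₂_ge : ∀ t, γ₂ * t + c₂ ≤ depart μ₂ (HDS.A2 μ₁ F₁ F₂) (depart μ₁ (HDS.A1 F₁ F₂) t)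
  depart₂_eq : ∀ t ∈ suppF F₂,
    depart μ₂ (HDS.A2 μ₁ F₁ F₂) (depart μ₁ (HDS.A1 F₁ F₂) t) = γ₂ * t + c₂
  before : ∀ t < b, F₂ t = 0
  mem : b ∈ suppF F₂

namespace HDS.Balance

variable {μ₁ μ₂ γ₁ γ₂ Λ₁ Λ₂ : ℝ} {F₁ F₂ : ℝ → ℝ} {c₁ c₂ b : ℝ}

local notation "A₁" => A1 F₁ F₂
local notation "τ₁" => depart μ₁ (A1 F₁ F₂)
local notation "A₂" => A2 μ₁ F₁ F₂
local notation "τ₂" => depart μ₂ (A2 μ₁ F₁ F₂)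

lemma cumA (E : Balance μ₁ μ₂ γ₁ γ₂ Λ₁ Λ₂ F₁ F₂ c₁ c₂ b) : IsCumulative A₁ :=
  isCumulative_A1 E.cum₁ E.cum₂

lemma inpA (E : Balance μ₁ μ₂ γ₁ γ₂ Λ₁ Λ₂ F₁ F₂ c₁ c₂ b) : IsInput A₂ :=
  isInput_A2 E.μ₁_pos E.cum₁ E.cum₂

lemma ge_b (E : Balance μ₁ μ₂ γ₁ γ₂ Λ₁ Λ₂ F₁ F₂ c₁ c₂ b) {t : ℝ} (ht : t ∈ suppF F₂) : b ≤ t :=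
  ge_of_mem_suppF E.cum₂ E.before ht

/-- Class 1 never arrives at a time at which the total arrival profile jumps. -/
lemma le_leftLim_of_mem (E : Balance μ₁ μ₂ γ₁ γ₂ Λ₁ Λ₂ F₁ F₂ c₁ c₂ b) {t : ℝ}
    (ht : t ∈ suppF F₁) : F₁ t ≤ Function.leftLim F₁ t ∧ F₂ t ≤ Function.leftLim F₂ t := by
  have hμ := E.μ₁_pos
  have h1 : ∀ s < t, s ≤ ((Function.leftLim A₁ t + idle μ₁ A₁ t) / μ₁ - c₁) / γ₁ := fun s hs => by
    rw [le_div_iff₀ E.γ₁_pos, le_sub_iff_add_le, le_div_iff₀ hμ]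
    have := E.cumA.mul_depart_le_leftLim hμ hs
    have := mul_le_mul_of_nonneg_left (E.depart₁_ge s) hμ.le
    linarith
  have h2 := le_of_forall_lt_imp_le_of_dense h1
  rw [le_div_iff₀ E.γ₁_pos, le_sub_iff_add_le, le_div_iff₀ hμ] at h2
  have h3 := E.cumA.mul_depart hμ t
  rw [E.depart₁_eq t ht] at h3
  have h4 : Function.leftLim A₁ t = Function.leftLim F₁ t + Function.leftLim F₂ t :=
    E.cum₁.leftLim_add E.cum₂ t
  have h5 : A₁ t = F₁ t + F₂ t := rfl
  have h6 := E.cum₁.mono.leftLim_le (le_refl t)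
  have h7 := E.cum₂.mono.leftLim_le (le_refl t)
  constructor <;> linarith

lemma leftCont₁ (E : Balance μ₁ μ₂ γ₁ γ₂ Λ₁ Λ₂ F₁ F₂ c₁ c₂ b) (t : ℝ) :
    F₁ t ≤ Function.leftLim F₁ t := by
  by_contra h
  exact h (E.le_leftLim_of_mem (mem_suppF_of_leftLim_lt E.cum₁ (not_le.1 h))).1

lemma A2_le_of_depart_gt (E : Balance μ₁ μ₂ γ₁ γ₂ Λ₁ Λ₂ F₁ F₂ c₁ c₂ b) {t x : ℝ} (hx : 0 < x)
    (ht : ∀ r, t < r → x < τ₁ r) : A₂ x ≤ F₂ t :=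
  E.cum₂.mono (le_of_forall_gt_imp_ge_of_dense fun r hr =>
    E.cumA.departInv_le E.μ₁_pos hx (ht r hr))

lemma le_A2_of_depart_le (E : Balance μ₁ μ₂ γ₁ γ₂ Λ₁ Λ₂ F₁ F₂ c₁ c₂ b) {t x : ℝ}
    (ht : τ₁ t ≤ x) : F₂ t ≤ A₂ x :=
  E.cum₂.mono (le_departInv E.μ₁_pos E.cumA.nonneg ht)

/-- Class 1 has completely arrived when class 2 starts. -/
lemma F1_b (E : Balance μ₁ μ₂ γ₁ γ₂ Λ₁ Λ₂ F₁ F₂ c₁ c₂ b) : F₁ b = Λ₁ := by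
  have hμ := E.μ₁_pos
  have hμ2 := E.μ₂_pos
  by_contra hne
  have hlt : F₁ b < Λ₁ := lt_of_le_of_ne (E.le₁ b) hne
  obtain ⟨y, hby, hyΛ⟩ := exists_between hlt
  obtain ⟨t, ht, hl, hr⟩ := E.cum₁.exists_last_le ⟨b, hby.le⟩
    (E.top₁.eventually (lt_mem_nhds hyΛ)).exists
  have hFt : F₁ t = y := le_antisymm
    ((E.leftCont₁ t).trans (E.cum₁.leftLim_le_of_forall_lt hl))
    (E.cum₁.le_of_forall_gt fun r h => (hr r h).le)
  have hbt : b < t := by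
    by_contra h
    have := E.cum₁.mono (not_lt.1 h)
    linarith
  have hxe : μ₁ * τ₁ t = F₁ t + F₂ t + idle μ₁ A₁ t := by
    have h1 := E.cumA.mul_depart hμ t
    have h2 := E.le_leftLim_of_mem ht
    have h4 : Function.leftLim A₁ t = Function.leftLim F₁ t + Function.leftLim F₂ t :=
      E.cum₁.leftLim_add E.cum₂ t
    have h5 : A₁ t = F₁ t + F₂ t := rfl
    have h6 := E.cumA.mul_depart_le hμ t
    linarith
  have hit := idle_nonneg μ₁ A₁ t
  have hy0 : 0 < y := (E.cum₁.nonneg b).trans_lt hby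
  have hF2t := E.cum₂.nonneg t
  have hx : 0 < τ₁ t := pos_of_mul_pos_right (by rw [hxe]; linarith) hμ.le
  have hA2 : A₂ (τ₁ t) ≤ F₂ t := by
    refine E.A2_le_of_depart_gt hx fun r h => ?_
    have h1 := E.cumA.le_mul_depart hμ h
    have h2 := idle_mono hμ E.cumA.nonneg h.le
    have h3 : A₁ t = F₁ t + F₂ t := rfl
    have h4 : A₁ r = F₁ r + F₂ r := rfl
    have h5 := E.cum₂.mono h.le
    have h6 := hr r h
    exact lt_of_mul_lt_mul_left (by linarith) hμ.le
  obtain ⟨u, hu⟩ : ∃ u, μ₁ * u = Function.leftLim A₁ b + idle μ₁ A₁ b :=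
    ⟨(Function.leftLim A₁ b + idle μ₁ A₁ b) / μ₁, by field_simp⟩
  have huF : μ₁ * u ≤ F₁ b + idle μ₁ A₁ b := by
    have : Function.leftLim A₁ b ≤ F₁ b := E.cumA.leftLim_le_of_forall_lt fun s hs => by
      have : A₁ s = F₁ s + F₂ s := rfl
      rw [this, E.before s hs, add_zero]
      exact E.cum₁.mono hs.le
    linarith
  have hu0 : 0 ≤ u := by
    have h1 := leftLim_nonneg E.cumA.nonneg b
    have h2 := idle_nonneg μ₁ A₁ b
    exact nonneg_of_mul_nonneg_right (by linarith) hμ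
  have hu1 : γ₁ * b + c₁ ≤ u := by
    have h1 : ∀ s < b, s ≤ (u - c₁) / γ₁ := fun s hs => by
      rw [le_div_iff₀ E.γ₁_pos, le_sub_iff_add_le]
      have h2 := E.cumA.mul_depart_le_leftLim hμ hs
      have h3 := le_of_mul_le_mul_left (by linarith : μ₁ * τ₁ s ≤ μ₁ * u) hμ
      linarith [E.depart₁_ge s]
    have := le_of_forall_lt_imp_le_of_dense h1
    rw [le_div_iff₀ E.γ₁_pos, le_sub_iff_add_le] at this
    linarith
  have hu2 : u ≤ γ₂ * b + c₂ := by
    rw [← E.depart₂_eq b E.mem]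
    refine le_trans ?_ (le_depart hμ2 E.inpA.nonneg _)
    refine le_of_mul_le_mul_left ?_ hμ
    have h1 := E.cumA.mul_depart hμ b
    have h2 := E.cumA.mono.leftLim_le (le_refl b)
    linarith
  have hδ : 0 < (y - F₁ b) / μ₁ := div_pos (by linarith) hμ
  set δ := (y - F₁ b) / μ₁ with hδe
  have hδμ : μ₁ * δ = y - F₁ b := by rw [hδe]; field_simp
  have hibt := idle_mono hμ E.cumA.nonneg hbt.le
  have hbase : μ₁ * (u + δ) + F₂ t ≤ μ₁ * τ₁ t := by linarith
  have hmul : μ₂ * (u + δ) ≤ μ₁ * (u + δ) :=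
    mul_le_mul_of_nonneg_right E.μ_lt.le (by linarith)
  have hmul0 : 0 ≤ μ₂ * (u + δ) := by positivity
  have hM2 : idle μ₂ A₂ (τ₁ t) ≤ μ₁ * τ₁ t - (μ₁ - μ₂) * (u + δ) - F₂ t := by
    refine idle_le (by linarith) fun s h0 hs => ?_
    rcases le_or_gt s (u + δ) with hsu | hsu
    · have := mul_le_mul_of_nonneg_left hsu hμ2.le
      linarith [E.inpA.nonneg s]
    · have hs0 : 0 < s := by linarith
      have h1 := E.cumA.mul_le_at_departInv hμ s
      have h2 : departInv μ₁ A₁ s ≤ t :=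
        (E.cumA.departInv_mono hμ (mem_Ioi.2 hs0) (mem_Ioi.2 hx) hs).trans
          (le_of_forall_gt_imp_ge_of_dense fun r h => E.cumA.departInv_le hμ hx (by
            have h1 := E.cumA.le_mul_depart hμ h
            have h2 := idle_mono hμ E.cumA.nonneg h.le
            have h3 : A₁ t = F₁ t + F₂ t := rfl
            have h4 : A₁ r = F₁ r + F₂ r := rfl
            have h5 := E.cum₂.mono h.le
            have h6 := hr r h
            exact lt_of_mul_lt_mul_left (by linarith) hμ.le))
      have h3 := idle_mono hμ E.cumA.nonneg h2
      have h4 := E.cum₁.mono h2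
      have h5 : A₁ (departInv μ₁ A₁ s) = F₁ (departInv μ₁ A₁ s) + A₂ s := rfl
      have h6 : (μ₁ - μ₂) * (u + δ) ≤ (μ₁ - μ₂) * s :=
        mul_le_mul_of_nonneg_left hsu.le (by linarith [E.μ_lt])
      linarith
  have hG := depart_le hμ2 E.inpA hx (right_A2 hμ E.cum₁ E.cum₂ hx)
  have hG2 := mul_le_mul_of_nonneg_left (E.depart₂_ge t) hμ2.le
  rw [E.depart₁_eq t ht] at *
  have e1 : μ₂ * u ≤ μ₂ * (γ₂ * b + c₂) := mul_le_mul_of_nonneg_left hu2 hμ2.le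
  have e2 : μ₁ * (γ₁ * b + c₁) ≤ μ₁ * u := mul_le_mul_of_nonneg_left hu1 hμ.le
  have e3 : μ₁ * γ₁ * (t - b) ≤ μ₂ * γ₂ * (t - b) :=
    mul_le_mul_of_nonneg_right E.rate_le (by linarith)
  have e4 : 0 < (μ₁ - μ₂) * δ := mul_pos (by linarith [E.μ_lt]) hδ
  nlinarith

lemma mem_le_b (E : Balance μ₁ μ₂ γ₁ γ₂ Λ₁ Λ₂ F₁ F₂ c₁ c₂ b) {t : ℝ} (ht : t ∈ suppF F₁) :
    t ≤ b :=
  le_of_mem_suppF E.cum₁ E.le₁ E.F1_b ht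

lemma idle1_eq_zero (E : Balance μ₁ μ₂ γ₁ γ₂ Λ₁ Λ₂ F₁ F₂ c₁ c₂ b) {t : ℝ}
    (ht : t ≤ γ₁ * t + c₁) : idle μ₁ A₁ t = 0 :=
  E.cumA.idle_eq_zero E.μ₁_pos E.γ₁_lt E.depart₁_ge ht

lemma le_line_of_mem (E : Balance μ₁ μ₂ γ₁ γ₂ Λ₁ Λ₂ F₁ F₂ c₁ c₂ b) {t : ℝ}
    (ht : t ∈ suppF F₁) : t ≤ γ₁ * t + c₁ := by
  rw [← E.depart₁_eq t ht]
  exact le_depart E.μ₁_pos E.cumA.nonneg t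

lemma F1_of_mem (E : Balance μ₁ μ₂ γ₁ γ₂ Λ₁ Λ₂ F₁ F₂ c₁ c₂ b) {t : ℝ}
    (ht : t ∈ suppF F₁) : F₁ t = μ₁ * (γ₁ * t + c₁) := by
  have h1 := E.cumA.mul_depart E.μ₁_pos t
  rw [E.idle1_eq_zero (E.le_line_of_mem ht), E.depart₁_eq t ht] at h1
  have h4 : Function.leftLim A₁ t = Function.leftLim F₁ t + Function.leftLim F₂ t :=
    E.cum₁.leftLim_add E.cum₂ t
  have h5 : A₁ t = F₁ t + F₂ t := rfl
  have h6 := E.le_leftLim_of_mem ht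
  have h7 := E.cum₁.mono.leftLim_le (le_refl t)
  have h8 : Function.leftLim F₂ t ≤ 0 := E.cum₂.leftLim_le_of_forall_lt fun s hs =>
    (E.before s (hs.trans_le (E.mem_le_b ht))).le
  have h9 := E.cum₂.nonneg t
  linarith

/-- The last arrival of class 1. -/
lemma exists_last₁ (E : Balance μ₁ μ₂ γ₁ γ₂ Λ₁ Λ₂ F₁ F₂ c₁ c₂ b) :
    ∃ f ∈ suppF F₁, F₁ f = Λ₁ ∧ ∀ r < f, F₁ r < Λ₁ := by
  obtain ⟨f, hf, hl, hge⟩ := E.cum₁.exists_first_ge ⟨b, E.F1_b.ge⟩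
    (E.cum₁.bot.eventually (gt_mem_nhds E.Λ₁_pos)).exists
  exact ⟨f, hf, le_antisymm (E.le₁ f) hge, hl⟩

lemma c2_le (E : Balance μ₁ μ₂ γ₁ γ₂ Λ₁ Λ₂ F₁ F₂ c₁ c₂ b) {u : ℝ}
    (hu₁ : ∀ x < u, ∃ t < b, x < τ₁ t) (hu₂ : ∀ t < b, ∃ s, t < s ∧ s < b ∧ 0 < τ₁ s ∧ τ₁ s < u) :
    γ₂ * b + c₂ ≤ u := by
  have key : ∀ t < b, t ≤ (u - c₂) / γ₂ := fun t ht => by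
    obtain ⟨s, hts, hsb, h0, hsu⟩ := hu₂ t ht
    obtain ⟨r, hrb, hr⟩ := hu₁ _ hsu
    have h1 : A₂ (τ₁ s) ≤ 0 := by
      rw [← E.before r hrb]
      exact E.cum₂.mono (E.cumA.departInv_le E.μ₁_pos h0 hr)
    have h2 := depart_le E.μ₂_pos E.inpA h0 (right_A2 E.μ₁_pos E.cum₁ E.cum₂ h0)
    have h3 := idle_le_mul E.μ₂_pos E.inpA.nonneg h0.le
    have h4 := le_of_mul_le_mul_left (by linarith : μ₂ * τ₂ (τ₁ s) ≤ μ₂ * τ₁ s) E.μ₂_pos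
    have h5 := E.depart₂_ge s
    have h6 := mul_le_mul_of_nonneg_left hts.le E.γ₂_pos.le
    rw [le_div_iff₀ E.γ₂_pos]
    linarith
  have := le_of_forall_lt_imp_le_of_dense key
  rw [le_div_iff₀ E.γ₂_pos] at this
  linarith

/-- If nobody arrives between the end of class 1 and the start of class 2, then class 1 leaves
without queueing. -/
lemma last₁_eq_of_lt (E : Balance μ₁ μ₂ γ₁ γ₂ Λ₁ Λ₂ F₁ F₂ c₁ c₂ b) {f : ℝ} (hf : f ∈ suppF F₁)
    (hF : F₁ f = Λ₁) (hfb : f < b) :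
    μ₁ * f = Λ₁ ∧ ∀ t, f < t → t < b → τ₁ t = t := by
  have hμ := E.μ₁_pos
  have hline := E.F1_of_mem hf
  have hle := E.le_line_of_mem hf
  have hτ : ∀ t, f < t → t < b → μ₁ * τ₁ t ≤ μ₁ * t := fun t h1 h2 => by
    have hA : A₁ t = A₁ f := by
      have e1 : A₁ t = F₁ t + F₂ t := rfl
      have e2 : A₁ f = F₁ f + F₂ f := rfl
      have e3 := E.cum₁.mono h1.le
      rw [e1, e2, E.before t h2, E.before f hfb]
      linarith [E.le₁ t]
    have h3 := E.cumA.mul_depart_le_of_const hμ hA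
    rw [E.idle1_eq_zero hle] at h3
    have h4 : A₁ f = Λ₁ := by
      have e2 : A₁ f = F₁ f + F₂ f := rfl
      rw [e2, E.before f hfb, hF, add_zero]
    have h5 := mul_le_mul_of_nonneg_left (E.depart₁_ge t) hμ.le
    have h6 : 0 < μ₁ * (γ₁ * (t - f)) := mul_pos hμ (mul_pos E.γ₁_pos (by linarith))
    rcases le_max_iff.1 h3 with h | h
    · nlinarith
    · exact h
  have hge : ∀ t, f < t → t < b → Λ₁ ≤ μ₁ * t := fun t h1 h2 => by
    have h5 := mul_le_mul_of_nonneg_left (E.depart₁_ge t) hμ.le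
    have h6 : 0 < μ₁ * (γ₁ * (t - f)) := mul_pos hμ (mul_pos E.γ₁_pos (by linarith))
    linarith [hτ t h1 h2]
  refine ⟨le_antisymm ?_ ?_, fun t h1 h2 => le_antisymm
    (le_of_mul_le_mul_left (hτ t h1 h2) hμ) (le_depart hμ E.cumA.nonneg t)⟩
  · rw [← hF, hline]
    exact mul_le_mul_of_nonneg_left hle hμ.le
  · have : Λ₁ / μ₁ ≤ f := le_of_forall_gt_imp_ge_of_dense fun t ht => by
      rcases lt_or_ge t b with h | h
      · rw [div_le_iff₀ hμ]
        linarith [hge t ht h]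
      · obtain ⟨r, h1, h2⟩ := exists_between hfb
        refine le_trans ?_ (h2.le.trans h)
        rw [div_le_iff₀ hμ]
        linarith [hge r h1 h2]
    rw [div_le_iff₀ hμ] at this
    linarith

lemma exists_mem_gt (E : Balance μ₁ μ₂ γ₁ γ₂ Λ₁ Λ₂ F₁ F₂ c₁ c₂ b) (h : F₂ b < Λ₂) :
    ∃ t ∈ suppF F₂, b < t := by
  obtain ⟨y, hby, hyΛ⟩ := exists_between h
  obtain ⟨t, ht, hl, hr⟩ := E.cum₂.exists_last_le ⟨b, hby.le⟩
    (E.top₂.eventually (lt_mem_nhds hyΛ)).exists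
  refine ⟨t, ht, lt_of_not_ge fun hle => ?_⟩
  have := E.cum₂.le_of_forall_gt fun r hr' => (hr r hr').le
  linarith [E.cum₂.mono hle]

lemma not_line_le_diag (E : Balance μ₁ μ₂ γ₁ γ₂ Λ₁ Λ₂ F₁ F₂ c₁ c₂ b) (hb : 0 < b)
    (h : γ₂ * b + c₂ ≤ b) : False := by
  have hμ := E.μ₁_pos
  have hγ := E.γ₂_lt
  have hF : Λ₂ ≤ F₂ b := by
    by_contra hlt
    obtain ⟨t, ht, hbt⟩ := E.exists_mem_gt (not_le.1 hlt)
    have h1 := E.depart₂_eq t ht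
    have h2 := le_depart E.μ₂_pos E.inpA.nonneg (τ₁ t)
    have h3 := le_depart hμ E.cumA.nonneg t
    nlinarith
  have h1 := E.depart₂_eq b E.mem
  have h2 := le_depart E.μ₂_pos E.inpA.nonneg (τ₁ b)
  have h3 := E.cumA.mul_depart hμ b
  have h4 : μ₁ * b ≤ Function.leftLim A₁ b + idle μ₁ A₁ b := E.cumA.le_leftLim_add_idle hμ
  have h5 : Function.leftLim A₁ b ≤ Λ₁ := E.cumA.leftLim_le_of_forall_lt fun s hs => by
    have : A₁ s = F₁ s + F₂ s := rfl
    rw [this, E.before s hs, add_zero]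
    exact E.le₁ s
  have h6 : A₁ b = F₁ b + F₂ b := rfl
  have h7 := E.F1_b
  have h8 := mul_le_mul_of_nonneg_left (by linarith : τ₁ b ≤ b) hμ.le
  linarith [E.Λ₂_pos]

/-- Class 2 starts exactly when class 1 ends, while queue 1 is still busy; the first class-2
arrival does not wait at queue 2. -/
lemma start₂ (E : Balance μ₁ μ₂ γ₁ γ₂ Λ₁ Λ₂ F₁ F₂ c₁ c₂ b) :
    b ∈ suppF F₁ ∧ μ₁ * (γ₁ * b + c₁) = Λ₁ ∧ μ₁ * (γ₂ * b + c₂) = Λ₁ ∧ μ₁ * b < Λ₁ := by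
  have hμ := E.μ₁_pos
  obtain ⟨f, hf, hF, hlt⟩ := E.exists_last₁
  have hline := E.F1_of_mem hf
  have hle := E.le_line_of_mem hf
  have hfb := E.mem_le_b hf
  have hv : 0 < γ₁ * f + c₁ :=
    pos_of_mul_pos_right (by rw [← hline, hF]; exact E.Λ₁_pos) hμ.le
  have hfeq : f = b := by
    by_contra hne
    have hfb' : f < b := lt_of_le_of_ne hfb hne
    obtain ⟨h1, h2⟩ := E.last₁_eq_of_lt hf hF hfb'
    have hf0 : 0 < f := pos_of_mul_pos_right (by rw [h1]; exact E.Λ₁_pos) hμ.le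
    refine E.not_line_le_diag (hf0.trans hfb') (E.c2_le (fun x hx => ?_) fun t ht => ?_)
    · obtain ⟨r, hr, hrb⟩ := exists_between hx
      exact ⟨r, hrb, hr.trans_le (le_depart hμ E.cumA.nonneg r)⟩
    · obtain ⟨r, hr, hrb⟩ := exists_between (max_lt ht hfb')
      have h3 := max_lt_iff.1 hr
      refine ⟨r, h3.1, hrb, ?_, ?_⟩ <;> rw [h2 r h3.2 hrb]
      · linarith
      · exact hrb
  subst hfeq
  have hc2 : γ₂ * f + c₂ ≤ γ₁ * f + c₁ := by
    refine E.c2_le (fun x hx => ?_) fun t ht => ?_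
    · obtain ⟨r, hr, hrb⟩ := exists_between
        (show (x - c₁) / γ₁ < f by rw [div_lt_iff₀ E.γ₁_pos]; linarith)
      rw [div_lt_iff₀ E.γ₁_pos] at hr
      exact ⟨r, hrb, by linarith [E.depart₁_ge r]⟩
    · obtain ⟨r, hr, hrb⟩ := exists_between
        (max_lt ht (show -c₁ / γ₁ < f by rw [div_lt_iff₀ E.γ₁_pos]; linarith))
      have h3 := max_lt_iff.1 hr
      have h4 := h3.2
      rw [div_lt_iff₀ E.γ₁_pos] at h4
      refine ⟨r, h3.1, hrb, by linarith [E.depart₁_ge r], ?_⟩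
      have h5 := E.cumA.mul_depart_le hμ r
      have h6 := idle_mono hμ E.cumA.nonneg hrb.le
      rw [E.idle1_eq_zero hle] at h6
      have h7 : A₁ r = F₁ r + F₂ r := rfl
      rw [E.before r hrb] at h7
      have h8 := hlt r hrb
      exact lt_of_mul_lt_mul_left (by linarith) hμ.le
  have hc2' : γ₁ * f + c₁ ≤ γ₂ * f + c₂ := by
    rw [← E.depart₂_eq f E.mem, ← E.depart₁_eq f hf]
    exact le_depart E.μ₂_pos E.inpA.nonneg _
  refine ⟨hf, by linarith, by rw [le_antisymm hc2 hc2']; linarith, ?_⟩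
  by_contra hge
  have h1 : γ₁ * f + c₁ ≤ f := le_of_mul_le_mul_left (by linarith) hμ
  exact E.not_line_le_diag (hv.trans_le h1) (hc2.trans h1)

lemma neg_div_lt_b (E : Balance μ₁ μ₂ γ₁ γ₂ Λ₁ Λ₂ F₁ F₂ c₁ c₂ b) : -c₁ / γ₁ < b := by
  have h := E.start₂.2.1
  have : 0 < γ₁ * b + c₁ := pos_of_mul_pos_right (by rw [h]; exact E.Λ₁_pos) E.μ₁_pos.le
  rw [div_lt_iff₀ E.γ₁_pos]
  linarith

lemma F1_eq (E : Balance μ₁ μ₂ γ₁ γ₂ Λ₁ Λ₂ F₁ F₂ c₁ c₂ b) {t : ℝ} (ht : b ≤ t) : F₁ t = Λ₁ :=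
  le_antisymm (E.le₁ t) (E.F1_b ▸ E.cum₁.mono ht)

/-- Class 2 has no atoms. -/
lemma leftCont₂ (E : Balance μ₁ μ₂ γ₁ γ₂ Λ₁ Λ₂ F₁ F₂ c₁ c₂ b) (t : ℝ) :
    F₂ t ≤ Function.leftLim F₂ t := by
  by_contra hlt
  rw [not_le] at hlt
  have hμ := E.μ₁_pos
  have ht := mem_suppF_of_leftLim_lt E.cum₂ hlt
  have hbt := E.ge_b ht
  have hL : Function.leftLim A₁ t = Function.leftLim F₁ t + Function.leftLim F₂ t :=
    E.cum₁.leftLim_add E.cum₂ t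
  have hA : A₁ t = F₁ t + F₂ t := rfl
  have hl1 := E.cum₁.mono.leftLim_le (le_refl t)
  obtain ⟨y, hy⟩ : ∃ y, μ₁ * y = Function.leftLim A₁ t + idle μ₁ A₁ t :=
    ⟨(Function.leftLim A₁ t + idle μ₁ A₁ t) / μ₁, by field_simp⟩
  have hbelow : ∀ r < t, τ₁ r ≤ y := fun r hr =>
    le_of_mul_le_mul_left (by rw [hy]; exact E.cumA.mul_depart_le_leftLim hμ hr) hμ
  have hxe := E.cumA.mul_depart hμ t
  have hyx : y < τ₁ t := lt_of_mul_lt_mul_left (by linarith) hμ.le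
  have hy0 : 0 ≤ y := by
    have h1 := leftLim_nonneg E.cumA.nonneg t
    have h2 := idle_nonneg μ₁ A₁ t
    exact nonneg_of_mul_nonneg_right (by linarith) hμ
  have hup : F₂ t + idle μ₂ A₂ (τ₁ t) ≤ μ₂ * (γ₂ * t + c₂) := by
    rw [← E.depart₂_eq t ht]
    refine le_depart_of_lt E.μ₂_pos E.inpA hy0 hyx
      (right_A2 hμ E.cum₁ E.cum₂ (hy0.trans_lt hyx)) fun s hs _ => E.cum₂.mono ?_
    exact le_of_forall_lt_imp_le_of_dense fun r hr =>
      le_departInv hμ E.cumA.nonneg ((hbelow r hr).trans hs.le)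
  have key : ∀ r < t, r ≤ (((Function.leftLim F₂ t + F₂ t) / 2 + idle μ₂ A₂ (τ₁ t)) / μ₂ - c₂) / γ₂ := by
    intro r hr
    obtain ⟨s, hs, hst⟩ := exists_between (max_lt hr (E.neg_div_lt_b.trans_le hbt))
    obtain ⟨hrs, hs0⟩ := max_lt_iff.1 hs
    rw [div_lt_iff₀ E.γ₁_pos] at hs0
    have hx0 : 0 < τ₁ s := by linarith [E.depart₁_ge s]
    have hsy := hbelow s hst
    have h1 : A₂ (τ₁ s) ≤ F₂ t := E.A2_le_of_depart_gt hx0 fun q hq =>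
      (hsy.trans_lt hyx).trans_le (E.cumA.depart_mono hμ hq.le)
    have h2 := depart_le_of_lt E.μ₂_pos E.inpA hx0 (right_A2 hμ E.cum₁ E.cum₂ hx0)
      (l := Function.leftLim F₂ t) fun x h0 hx => by
        obtain ⟨q, hq, hxq⟩ : ∃ q < t, x < τ₁ q := by
          by_contra hne
          push Not at hne
          have := E.cumA.leftLim_add_idle_le hμ fun q hq =>
            mul_le_mul_of_nonneg_left (hne q hq) hμ.le
          rw [← hy] at this
          linarith [le_of_mul_le_mul_left this hμ]
        exact (E.cum₂.mono (E.cumA.departInv_le hμ h0 hxq)).trans (E.cum₂.mono.le_leftLim hq)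
    have h3 := idle_mono E.μ₂_pos E.inpA.nonneg (hsy.trans hyx.le)
    have h4 := mul_le_mul_of_nonneg_left (E.depart₂_ge s) E.μ₂_pos.le
    have h5 := mul_le_mul_of_nonneg_left hrs.le E.γ₂_pos.le
    have h6 := mul_le_mul_of_nonneg_left h5 E.μ₂_pos.le
    rw [le_div_iff₀ E.γ₂_pos, le_sub_iff_add_le, le_div_iff₀ E.μ₂_pos]
    linarith
  have := le_of_forall_lt_imp_le_of_dense key
  rw [le_div_iff₀ E.γ₂_pos, le_sub_iff_add_le, le_div_iff₀ E.μ₂_pos] at this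
  linarith

lemma le_leftLim_A1 (E : Balance μ₁ μ₂ γ₁ γ₂ Λ₁ Λ₂ F₁ F₂ c₁ c₂ b) (t : ℝ) :
    A₁ t ≤ Function.leftLim A₁ t := by
  have hL : Function.leftLim A₁ t = Function.leftLim F₁ t + Function.leftLim F₂ t :=
    E.cum₁.leftLim_add E.cum₂ t
  rw [hL]
  exact add_le_add (E.leftCont₁ t) (E.leftCont₂ t)

lemma continuous_A1 (E : Balance μ₁ μ₂ γ₁ γ₂ Λ₁ Λ₂ F₁ F₂ c₁ c₂ b) : Continuous A₁ := by
  rw [continuous_iff_continuousAt]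
  intro t
  rw [continuousAt_iff_continuous_left_right]
  refine ⟨?_, E.cumA.right t⟩
  rw [← continuousWithinAt_Iio_iff_Iic]
  have := E.cumA.mono.tendsto_leftLim t
  rwa [le_antisymm (E.cumA.mono.leftLim_le le_rfl) (E.le_leftLim_A1 t)] at this

lemma mul_tau1 (E : Balance μ₁ μ₂ γ₁ γ₂ Λ₁ Λ₂ F₁ F₂ c₁ c₂ b) (t : ℝ) :
    μ₁ * τ₁ t = A₁ t + idle μ₁ A₁ t := by
  have h1 := E.cumA.mul_depart E.μ₁_pos t
  have h2 := E.le_leftLim_A1 t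
  have h3 := E.cumA.mono.leftLim_le (le_refl t)
  linarith

lemma A2_tau1_le (E : Balance μ₁ μ₂ γ₁ γ₂ Λ₁ Λ₂ F₁ F₂ c₁ c₂ b) (t : ℝ) :
    A₂ (τ₁ t) ≤ F₂ t := by
  have hμ := E.μ₁_pos
  have ht := le_departInv hμ E.cumA.nonneg (le_refl (τ₁ t))
  have h1 := E.cumA.leftLim_add_idle_le hμ (t := departInv μ₁ A₁ (τ₁ t)) (K := μ₁ * τ₁ t)
    fun r hr => by
      obtain ⟨s, hs, hrs⟩ := exists_lt_of_lt_csSup ⟨t, le_refl (τ₁ t)⟩ hr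
      exact mul_le_mul_of_nonneg_left ((E.cumA.depart_mono hμ hrs.le).trans hs) hμ.le
  have h2 := E.le_leftLim_A1 (departInv μ₁ A₁ (τ₁ t))
  have h3 := idle_mono hμ E.cumA.nonneg ht
  have h4 := E.mul_tau1 t
  have h5 : A₁ t = F₁ t + F₂ t := rfl
  have h6 : A₁ (departInv μ₁ A₁ (τ₁ t)) = F₁ (departInv μ₁ A₁ (τ₁ t)) + A₂ (τ₁ t) := rfl
  have h7 := E.cum₁.mono ht
  linarith

lemma exists_idle1_eq (E : Balance μ₁ μ₂ γ₁ γ₂ Λ₁ Λ₂ F₁ F₂ c₁ c₂ b) {t : ℝ}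
    (ht : 0 < idle μ₁ A₁ t) : ∃ r, 0 ≤ r ∧ r ≤ t ∧ b < r ∧ τ₁ r = r ∧
      idle μ₁ A₁ t = μ₁ * r - Λ₁ - F₂ r := by
  have hμ := E.μ₁_pos
  have ht0 : 0 ≤ t := by
    by_contra h
    exact ht.ne' (idle_of_nonpos E.cumA.nonneg (not_le.1 h).le)
  obtain ⟨r, ⟨hr0, hrt⟩, hr⟩ := isCompact_Icc.exists_sSup_image_eq (nonempty_Icc.2 ht0)
    ((continuous_const.mul continuous_id).sub E.continuous_A1 |>.max
      (continuous_const (y := (0 : ℝ)))).continuousOn (f := fun s => max (μ₁ * s - A₁ s) 0)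
  change idle μ₁ A₁ t = max (μ₁ * r - A₁ r) 0 at hr
  have hr' : idle μ₁ A₁ t = μ₁ * r - A₁ r := by
    rcases max_cases (μ₁ * r - A₁ r) 0 with h | h <;> linarith
  have h1 := le_idle hμ E.cumA.nonneg hr0 (le_refl r)
  have h2 := idle_mono hμ E.cumA.nonneg hrt
  have hbr : b < r := by
    by_contra h
    have h3 := idle_mono hμ E.cumA.nonneg (not_lt.1 h)
    rw [E.idle1_eq_zero (E.le_line_of_mem E.start₂.1)] at h3
    linarith
  refine ⟨r, hr0, hrt, hbr, ?_, ?_⟩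
  · refine mul_left_cancel₀ hμ.ne' ?_
    linarith [E.mul_tau1 r]
  · have : A₁ r = F₁ r + F₂ r := rfl
    rw [hr', this, E.F1_eq hbr.le]
    ring

/-- Queue 2 does not idle after the first departure of class 2 from queue 1, as long as the
isocost line of class 2 is above the diagonal. -/
lemma idle2_le_of_lt (E : Balance μ₁ μ₂ γ₁ γ₂ Λ₁ Λ₂ F₁ F₂ c₁ c₂ b) {x : ℝ}
    (hx : x < γ₂ * x + c₂) : idle μ₂ A₂ x ≤ μ₂ * (γ₂ * b + c₂) := by
  have hμ := E.μ₁_pos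
  have hμ2 := E.μ₂_pos
  obtain ⟨-, -, hv, -⟩ := E.start₂
  have hv0 : 0 < γ₂ * b + c₂ := pos_of_mul_pos_right (by rw [hv]; exact E.Λ₁_pos) hμ.le
  set v := γ₂ * b + c₂ with hve
  have hη : 0 < μ₂ * (c₂ - (1 - γ₂) * x) := mul_pos hμ2 (by linarith)
  suffices h : idle μ₂ A₂ x ≤ max (μ₂ * v) (idle μ₂ A₂ x - μ₂ * (c₂ - (1 - γ₂) * x)) by
    rcases le_max_iff.1 h with h | h
    · exact h
    · linarith
  have hv1 : 0 ≤ μ₂ * v := by positivity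
  refine idle_le (hv1.trans (le_max_left _ _)) fun s h0 hs => ?_
  rcases h0.eq_or_lt with rfl | h0
  · exact le_max_of_le_left (by linarith [E.inpA.nonneg 0])
  rcases le_or_gt s v with hsv | hsv
  · exact le_max_of_le_left (by linarith [E.inpA.nonneg s, mul_le_mul_of_nonneg_left hsv hμ2.le])
  have hts := E.cumA.departInv_le_self hμ h0
  have h1 := E.cumA.mul_le_at_departInv hμ s
  have h2 : A₁ (departInv μ₁ A₁ s) = F₁ (departInv μ₁ A₁ s) + A₂ s := rfl
  have h3 := E.le₁ (departInv μ₁ A₁ s)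
  rcases (idle_nonneg μ₁ A₁ (departInv μ₁ A₁ s)).eq_or_lt with h4 | h4
  · refine le_max_of_le_left ?_
    have h5 : (μ₁ - μ₂) * v ≤ (μ₁ - μ₂) * s :=
      mul_le_mul_of_nonneg_left hsv.le (by linarith [E.μ_lt])
    linarith
  · refine le_max_of_le_right ?_
    obtain ⟨r, hr0, hrt, hbr, hτ, hr⟩ := E.exists_idle1_eq h4
    have h5 : (μ₁ - μ₂) * r ≤ (μ₁ - μ₂) * s :=
      mul_le_mul_of_nonneg_left (hrt.trans hts) (by linarith [E.μ_lt])
    have h6 := mul_le_mul_of_nonneg_left (E.depart₂_ge r) hμ2.le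
    have h7 := E.A2_tau1_le r
    rw [hτ] at h6 h7
    have hr1 : 0 < r := by
      refine hr0.lt_of_ne ?_
      rintro rfl
      linarith [E.cum₂.nonneg 0, E.Λ₁_pos]
    have h8 := depart_le hμ2 E.inpA hr1 (right_A2 hμ E.cum₁ E.cum₂ hr1)
    have hrx := (hrt.trans hts).trans hs
    have h9 := idle_mono hμ2 E.inpA.nonneg hrx
    have h10 : μ₂ * ((1 - γ₂) * r) ≤ μ₂ * ((1 - γ₂) * x) :=
      mul_le_mul_of_nonneg_left (mul_le_mul_of_nonneg_left hrx (by linarith [E.γ₂_lt])) hμ2.le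
    linarith

lemma idle2_le (E : Balance μ₁ μ₂ γ₁ γ₂ Λ₁ Λ₂ F₁ F₂ c₁ c₂ b) {x : ℝ}
    (hx : x ≤ γ₂ * x + c₂) : idle μ₂ A₂ x ≤ μ₂ * (γ₂ * b + c₂) := by
  refine le_of_forall_pos_le_add fun ε hε => ?_
  have hμ2 := E.μ₂_pos
  have hd : 0 < ε / μ₂ := div_pos hε hμ2
  have h1 := idle_le_add hμ2 E.inpA (show x - ε / μ₂ ≤ x by linarith)
  have h2 := E.idle2_le_of_lt (x := x - ε / μ₂) (by nlinarith [E.γ₂_lt])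
  have h3 : μ₂ * (x - (x - ε / μ₂)) = ε := by field_simp; ring
  linarith

lemma le_idle2 (E : Balance μ₁ μ₂ γ₁ γ₂ Λ₁ Λ₂ F₁ F₂ c₁ c₂ b) {x : ℝ}
    (hx : γ₂ * b + c₂ ≤ x) : μ₂ * (γ₂ * b + c₂) ≤ idle μ₂ A₂ x := by
  have hμ := E.μ₁_pos
  have hμ2 := E.μ₂_pos
  obtain ⟨-, hv₁, hv, -⟩ := E.start₂
  have hv0 : 0 < γ₂ * b + c₂ := pos_of_mul_pos_right (by rw [hv]; exact E.Λ₁_pos) hμ.le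
  have hvv : γ₁ * b + c₁ = γ₂ * b + c₂ := mul_left_cancel₀ hμ.ne' (hv₁.trans hv.symm)
  set v := γ₂ * b + c₂ with hve
  have key : ∀ s < v, s ≤ idle μ₂ A₂ x / μ₂ := fun s hs => by
    rw [le_div_iff₀ hμ2, mul_comm]
    rcases le_or_gt s 0 with h0 | h0
    · exact (mul_nonpos_of_nonneg_of_nonpos hμ2.le h0).trans (idle_nonneg _ _ _)
    obtain ⟨r, hr, hrb⟩ := exists_between
      (show (s - c₁) / γ₁ < b by rw [div_lt_iff₀ E.γ₁_pos]; linarith)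
    rw [div_lt_iff₀ E.γ₁_pos] at hr
    have h1 : A₂ s ≤ F₂ r := E.cum₂.mono
      (E.cumA.departInv_le hμ h0 (by linarith [E.depart₁_ge r]))
    rw [E.before r hrb] at h1
    have h2 := le_idle hμ2 E.inpA.nonneg h0.le (hs.le.trans hx)
    linarith
  have := le_of_forall_lt_imp_le_of_dense key
  rwa [le_div_iff₀ hμ2, mul_comm] at this

lemma F2_of_mem (E : Balance μ₁ μ₂ γ₁ γ₂ Λ₁ Λ₂ F₁ F₂ c₁ c₂ b) {t : ℝ}
    (ht : t ∈ suppF F₂) : F₂ t = μ₂ * γ₂ * (t - b) := by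
  have hμ := E.μ₁_pos
  have hμ2 := E.μ₂_pos
  obtain ⟨-, hv₁, hv, -⟩ := E.start₂
  have hv0 : 0 < γ₂ * b + c₂ := pos_of_mul_pos_right (by rw [hv]; exact E.Λ₁_pos) hμ.le
  have hvv : γ₁ * b + c₁ = γ₂ * b + c₂ := mul_left_cancel₀ hμ.ne' (hv₁.trans hv.symm)
  have hbt := E.ge_b ht
  have hτ := E.depart₂_eq t ht
  have hx1 := le_depart hμ2 E.inpA.nonneg (τ₁ t)
  have hx2 := mul_le_mul_of_nonneg_left (le_depart hμ E.cumA.nonneg t) E.γ₂_pos.le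
  have hx3 : γ₂ * b + c₂ ≤ τ₁ t := by
    linarith [E.depart₁_ge t, mul_le_mul_of_nonneg_left hbt E.γ₁_pos.le]
  have hx0 := hv0.trans_le hx3
  have hR := right_A2 hμ E.cum₁ E.cum₂ hx0
  have hi1 := E.idle2_le (x := τ₁ t) (by linarith)
  have hi2 := E.le_idle2 hx3
  have hup := depart_le hμ2 E.inpA hx0 hR
  have hA := E.A2_tau1_le t
  suffices h : F₂ t + idle μ₂ A₂ (τ₁ t) ≤ μ₂ * τ₂ (τ₁ t) by
    rw [hτ] at hup h
    linarith
  rcases (E.cum₂.nonneg t).eq_or_lt with h0 | h0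
  · rw [← h0]
    linarith [mul_le_mul_of_nonneg_left (hx3.trans hx1) hμ2.le]
  rw [← le_sub_iff_add_le]
  refine le_of_forall_lt_imp_le_of_dense fun B hB => ?_
  refine (le_max_left B (F₂ t / 2)).trans ?_
  obtain ⟨r, hr, hl, hge⟩ := E.cum₂.exists_first_ge (y := max B (F₂ t / 2))
    ⟨t, max_le hB.le (by linarith)⟩ ⟨b - 1, by
      rw [E.before _ (by linarith)]
      exact lt_max_of_lt_right (by linarith)⟩
  have hrB : F₂ r = max B (F₂ t / 2) := le_antisymm
    ((E.leftCont₂ r).trans (E.cum₂.leftLim_le_of_forall_lt fun s hs => (hl s hs).le)) hge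
  have hrt : F₂ r < F₂ t := by rw [hrB]; exact max_lt hB (by linarith)
  have hrt' : r < t := lt_of_not_ge fun h => hrt.not_ge (E.cum₂.mono h)
  have hlt : τ₁ r < τ₁ t := by
    have h1 := E.mul_tau1 r
    have h2 := E.mul_tau1 t
    have h3 := idle_mono hμ E.cumA.nonneg hrt'.le
    have h4 := E.cum₁.mono hrt'.le
    have h5 : A₁ r = F₁ r + F₂ r := rfl
    have h6 : A₁ t = F₁ t + F₂ t := rfl
    exact lt_of_mul_lt_mul_left (by linarith) hμ.le
  rw [le_sub_iff_add_le, ← hrB]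
  exact le_depart_of_lt hμ2 E.inpA (depart_nonneg hμ E.cumA.nonneg r) hlt hR
    fun s hs _ => E.le_A2_of_depart_le hs.le

lemma F2_eq_ramp (E : Balance μ₁ μ₂ γ₁ γ₂ Λ₁ Λ₂ F₁ F₂ c₁ c₂ b) :
    F₂ = ramp (μ₂ * γ₂) b (b + Λ₂ / (μ₂ * γ₂)) := by
  have hr : 0 < μ₂ * γ₂ := mul_pos E.μ₂_pos E.γ₂_pos
  have hd : 0 < Λ₂ / (μ₂ * γ₂) := div_pos E.Λ₂_pos hr
  refine E.cum₂.eq_ramp E.le₂ ?_ hr (by linarith)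
    ⟨b - 1, (E.before _ (by linarith)).le⟩ E.top₂ E.leftCont₂ fun t ht => E.F2_of_mem ht
  rw [add_sub_cancel_left, mul_div_cancel₀ _ hr.ne']

lemma F1_eq_ramp (E : Balance μ₁ μ₂ γ₁ γ₂ Λ₁ Λ₂ F₁ F₂ c₁ c₂ b) :
    F₁ = ramp (μ₁ * γ₁) (b - Λ₁ / (μ₁ * γ₁)) b := by
  have hr : 0 < μ₁ * γ₁ := mul_pos E.μ₁_pos E.γ₁_pos
  have hd : 0 < Λ₁ / (μ₁ * γ₁) := div_pos E.Λ₁_pos hr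
  have hne := hr.ne'
  have hdm : μ₁ * γ₁ * (Λ₁ / (μ₁ * γ₁)) = Λ₁ := mul_div_cancel₀ _ hne
  refine E.cum₁.eq_ramp E.le₁ ?_ hr (by linarith) ⟨-c₁ / γ₁ - 1, ?_⟩ E.top₁ E.leftCont₁
    fun t ht => ?_
  · linarith
  · by_contra h
    rw [not_le] at h
    obtain ⟨t, ht, hl, hge⟩ := E.cum₁.exists_first_ge ⟨_, le_refl (F₁ (-c₁ / γ₁ - 1))⟩
      (E.cum₁.bot.eventually (gt_mem_nhds h)).exists
    have h1 : t ≤ -c₁ / γ₁ - 1 := le_of_not_gt fun hlt => (hl _ hlt).ne rfl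
    have h2 := E.F1_of_mem ht
    have h3 := E.cum₁.nonneg t
    have h4 : 0 ≤ γ₁ * t + c₁ := nonneg_of_mul_nonneg_right (by linarith) E.μ₁_pos
    have h5 : t < -c₁ / γ₁ := by linarith
    rw [lt_div_iff₀ E.γ₁_pos] at h5
    linarith
  · rw [E.F1_of_mem ht, ← sub_eq_zero]
    linarith [E.start₂.2.1]

/-- The last arrival of class 2 finds both queues empty. -/
lemma last₂ (E : Balance μ₁ μ₂ γ₁ γ₂ Λ₁ Λ₂ F₁ F₂ c₁ c₂ b) :
    b + Λ₂ / (μ₂ * γ₂) = Λ₁ / μ₁ + Λ₂ / μ₂ := by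
  have hμ := E.μ₁_pos
  have hμ2 := E.μ₂_pos
  have hγ := E.γ₂_pos
  obtain ⟨-, hv₁, hv, -⟩ := E.start₂
  have hv0 : 0 < γ₂ * b + c₂ := pos_of_mul_pos_right (by rw [hv]; exact E.Λ₁_pos) hμ.le
  have hvv : γ₁ * b + c₁ = γ₂ * b + c₂ := mul_left_cancel₀ hμ.ne' (hv₁.trans hv.symm)
  have hvd : γ₂ * b + c₂ = Λ₁ / μ₁ := by rw [← hv]; field_simp
  set f := b + Λ₂ / (μ₂ * γ₂) with hf
  have hFf : Λ₂ ≤ F₂ f := by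
    have hd : 0 ≤ Λ₂ / (μ₂ * γ₂) := by have := E.Λ₂_pos; positivity
    rw [E.F2_eq_ramp, ← hf]
    simp only [ramp, min_self]
    rw [max_eq_right (by linarith), hf]
    field_simp
    linarith
  have hg : γ₂ * f + c₂ = Λ₁ / μ₁ + Λ₂ / μ₂ := by
    rw [← hvd, hf]
    field_simp
    ring
  have hg' : μ₂ * (γ₂ * f + c₂) = μ₂ * (γ₂ * b + c₂) + Λ₂ := by
    rw [hg, hvd]
    field_simp
  rw [← hg]
  obtain ⟨q, hq, hql, hqF⟩ := E.cum₂.exists_first_ge ⟨f, hFf⟩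
    (E.cum₂.bot.eventually (gt_mem_nhds E.Λ₂_pos)).exists
  have hqf : q = f := by
    have h1 := E.F2_of_mem hq
    rw [le_antisymm (E.le₂ q) hqF] at h1
    rw [hf, h1]
    field_simp
    ring
  rw [hqf] at hq hqF
  have h1 := E.depart₂_eq f hq
  have h2 := le_depart hμ2 E.inpA.nonneg (τ₁ f)
  have h3 := le_depart hμ E.cumA.nonneg f
  refine le_antisymm (by linarith) (le_of_not_gt fun hlt => ?_)
  obtain ⟨t, hqt, htg⟩ := exists_between hlt
  have hbq := E.ge_b hq
  have hA : A₁ t = A₁ f := by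
    have e1 : A₁ t = F₁ t + F₂ t := rfl
    have e2 : A₁ f = F₁ f + F₂ f := rfl
    rw [e1, e2, E.F1_eq hbq, E.F1_eq (hbq.trans hqt.le), le_antisymm (E.le₂ f) hqF,
      le_antisymm (E.le₂ t) (hqF.trans (E.cum₂.mono hqt.le))]
  have h4 := E.cumA.mul_depart_le_of_const hμ hA
  rw [← E.mul_tau1 f] at h4
  have h5 : τ₁ t ≤ γ₂ * f + c₂ := by
    rcases le_max_iff.1 h4 with h | h
    · linarith [le_of_mul_le_mul_left h hμ]
    · linarith [le_of_mul_le_mul_left h hμ]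
  have h6 := mul_le_mul_of_nonneg_left (le_depart hμ E.cumA.nonneg t) hγ.le
  have h6' := mul_lt_mul_of_pos_left hqt hγ
  have h7 := E.idle2_le (x := τ₁ t) (by linarith)
  have hx0 : 0 < τ₁ t := by
    have := mul_le_mul_of_nonneg_left (hbq.trans hqt.le) E.γ₁_pos.le
    linarith [E.depart₁_ge t]
  have h8 := depart_le hμ2 E.inpA hx0 (right_A2 hμ E.cum₁ E.cum₂ hx0)
  have h9 : A₂ (τ₁ t) ≤ Λ₂ := E.le₂ _
  have h10 := mul_le_mul_of_nonneg_left (E.depart₂_ge t) hμ2.le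
  have h11 := mul_lt_mul_of_pos_left h6' hμ2
  linarith

end HDS.Balance

lemma HDS.IsEAP.exists_balance {μ₁ μ₂ γ₁ γ₂ Λ₁ Λ₂ : ℝ} {P₁ : ArrivalProfile Λ₁}
    {P₂ : ArrivalProfile Λ₂} (hE : HDS.IsEAP μ₁ μ₂ γ₁ γ₂ Λ₁ Λ₂ P₁ P₂)
    (hμ₁ : 0 < μ₁) (hμ₂ : 0 < μ₂) (hμ : μ₂ < μ₁) (hγ₁ : γ₁ ∈ Ioo (0 : ℝ) 1)
    (hγ₂ : γ₂ ∈ Ioo (0 : ℝ) 1) (hle : μ₁ * γ₁ ≤ μ₂ * γ₂) (hΛ₁ : 0 < Λ₁) (hΛ₂ : 0 < Λ₂) :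
    ∃ c₁ c₂ b, HDS.Balance μ₁ μ₂ γ₁ γ₂ Λ₁ Λ₂ P₁.F P₂.F c₁ c₂ b := by
  have hC₁ := P₁.isCumulative
  have hC₂ := P₂.isCumulative
  have hA := isCumulative_A1 hC₁ hC₂
  have hA2 := isInput_A2 hμ₁ hC₁ hC₂
  obtain ⟨t₁, ht₁, -⟩ := hC₁.exists_last_le (y := Λ₁ / 2)
    ((hC₁.bot.eventually (gt_mem_nhds (half_pos hΛ₁))).exists.imp fun _ h => h.le)
    (P₁.tendsto_top.eventually (lt_mem_nhds (half_lt_self hΛ₁))).exists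
  obtain ⟨t₂, ht₂, -⟩ := hC₂.exists_last_le (y := Λ₂ / 2)
    ((hC₂.bot.eventually (gt_mem_nhds (half_pos hΛ₂))).exists.imp fun _ h => h.le)
    (P₂.tendsto_top.eventually (lt_mem_nhds (half_lt_self hΛ₂))).exists
  have h1 := fun s => hE.1 t₁ ht₁ s
  have h2 := fun s => hE.2 t₂ ht₂ s
  have h1' := fun t ht => hE.1 t ht t₁
  have h2' := fun t ht => hE.2 t ht t₂
  simp only [cost1_eq] at h1 h1'
  simp only [cost2_eq] at h2 h2'
  set c₁ := depart μ₁ (A1 P₁.F P₂.F) t₁ - γ₁ * t₁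
  set c₂ := depart μ₂ (A2 μ₁ P₁.F P₂.F) (depart μ₁ (A1 P₁.F P₂.F) t₂) - γ₂ * t₂
  have heq₂ : ∀ t ∈ suppF P₂.F,
      depart μ₂ (A2 μ₁ P₁.F P₂.F) (depart μ₁ (A1 P₁.F P₂.F) t) = γ₂ * t + c₂ :=
    fun t ht => by linarith [h2' t ht, h2 t]
  have hzero : P₂.F (-c₂ / γ₂ - 1) ≤ 0 := by
    by_contra h
    rw [not_le] at h
    obtain ⟨t, ht, hl, -⟩ := hC₂.exists_first_ge ⟨_, le_refl (P₂.F (-c₂ / γ₂ - 1))⟩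
      (hC₂.bot.eventually (gt_mem_nhds h)).exists
    have h3 : t ≤ -c₂ / γ₂ - 1 := le_of_not_gt fun hlt => (hl _ hlt).ne rfl
    have h4 := depart_nonneg hμ₂ hA2.nonneg (depart μ₁ (A1 P₁.F P₂.F) t)
    rw [heq₂ t ht] at h4
    have h5 : t < -c₂ / γ₂ := by linarith
    rw [lt_div_iff₀ hγ₂.1] at h5
    linarith
  obtain ⟨b, hb, hbl, -⟩ := hC₂.exists_last_le (y := 0) ⟨_, hzero⟩
    (P₂.tendsto_top.eventually (lt_mem_nhds hΛ₂)).exists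
  exact ⟨c₁, c₂, b,
    { μ₁_pos := hμ₁
      μ₂_pos := hμ₂
      μ_lt := hμ
      γ₁_pos := hγ₁.1
      γ₁_lt := hγ₁.2
      γ₂_pos := hγ₂.1
      γ₂_lt := hγ₂.2
      rate_le := hle
      Λ₁_pos := hΛ₁
      Λ₂_pos := hΛ₂
      cum₁ := hC₁
      cum₂ := hC₂
      le₁ := fun t => (P₁.mem_Icc t).2
      le₂ := fun t => (P₂.mem_Icc t).2
      top₁ := P₁.tendsto_top
      top₂ := P₂.tendsto_top
      depart₁_ge := fun t => by linarith [h1 t]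
      depart₁_eq := fun t ht => by linarith [h1' t ht, h1 t]
      depart₂_ge := fun t => by linarith [h2 t]
      depart₂_eq := heq₂
      before := fun t ht => le_antisymm (hbl t ht) (hC₂.nonneg t)
      mem := hb }⟩

/-- Uniqueness of the equilibrium. -/
lemma HDS.IsEAP.eq_ramp {μ₁ μ₂ γ₁ γ₂ Λ₁ Λ₂ : ℝ} {P₁ : ArrivalProfile Λ₁}
    {P₂ : ArrivalProfile Λ₂} (hE : HDS.IsEAP μ₁ μ₂ γ₁ γ₂ Λ₁ Λ₂ P₁ P₂)
    (hμ₁ : 0 < μ₁) (hμ₂ : 0 < μ₂) (hμ : μ₂ < μ₁) (hγ₁ : γ₁ ∈ Ioo (0 : ℝ) 1)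
    (hγ₂ : γ₂ ∈ Ioo (0 : ℝ) 1) (hle : μ₁ * γ₁ ≤ μ₂ * γ₂) (hΛ₁ : 0 < Λ₁) (hΛ₂ : 0 < Λ₂) :
    P₁.F = ramp (μ₁ * γ₁) (s8T1a μ₁ μ₂ γ₁ γ₂ Λ₁ Λ₂) (s8T1f μ₁ μ₂ γ₁ γ₂ Λ₁ Λ₂) ∧
    P₂.F = ramp (μ₂ * γ₂) (s8T1f μ₁ μ₂ γ₁ γ₂ Λ₁ Λ₂) (s8T2f μ₁ μ₂ γ₁ γ₂ Λ₁ Λ₂) := by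
  obtain ⟨c₁, c₂, b, E⟩ := hE.exists_balance hμ₁ hμ₂ hμ hγ₁ hγ₂ hle hΛ₁ hΛ₂
  have hf := E.last₂
  have hb : b = s8T1f μ₁ μ₂ γ₁ γ₂ Λ₁ Λ₂ := by
    have h1 : Λ₂ / (μ₂ * γ₂) = 1 / γ₂ * (Λ₂ / μ₂) := by
      rw [div_mul_div_comm, one_mul, mul_comm]
    rw [s8T1f]
    linarith
  have ha : b - Λ₁ / (μ₁ * γ₁) = s8T1a μ₁ μ₂ γ₁ γ₂ Λ₁ Λ₂ := by
    have h1 : Λ₁ / (μ₁ * γ₁) = 1 / γ₁ * (Λ₁ / μ₁) := by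
      rw [div_mul_div_comm, one_mul, mul_comm]
    rw [hb, s8T1f, s8T1a]
    linarith
  have h1 := E.F1_eq_ramp
  have h2 := E.F2_eq_ramp
  rw [ha, hb] at h1
  rw [hf, hb] at h2
  exact ⟨h1, h2⟩

section Ramp

variable {r a b : ℝ}

lemma ramp_of_le {t : ℝ} (h : t ≤ a) : ramp r a b t = 0 := by
  rw [ramp, max_eq_left (by linarith [min_le_left t b]), mul_zero]

lemma ramp_of_mem {t : ℝ} (ha : a ≤ t) (hb : t ≤ b) : ramp r a b t = r * (t - a) := by
  rw [ramp, min_eq_left hb, max_eq_right (by linarith)]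

lemma ramp_of_ge {t : ℝ} (hab : a ≤ b) (h : b ≤ t) : ramp r a b t = r * (b - a) := by
  rw [ramp, min_eq_right h, max_eq_right (by linarith)]

lemma le_ramp (hr : 0 ≤ r) {t : ℝ} (h : t ≤ b) : r * (t - a) ≤ ramp r a b t := by
  rw [ramp, min_eq_left h]
  exact mul_le_mul_of_nonneg_left (le_max_right _ _) hr

lemma ramp_mono (hr : 0 ≤ r) : Monotone (ramp r a b) := fun s t h =>
  mul_le_mul_of_nonneg_left
    (max_le_max le_rfl (sub_le_sub_right (min_le_min h le_rfl) a)) hr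

lemma continuous_ramp : Continuous (ramp r a b) := by
  unfold ramp
  fun_prop

lemma ramp_sub_le (hr : 0 ≤ r) {s t : ℝ} (h : s ≤ t) :
    ramp r a b t - ramp r a b s ≤ r * (t - s) := by
  rw [ramp, ramp, ← mul_sub]
  refine mul_le_mul_of_nonneg_left ?_ hr
  have h1 : min t b ≤ min s b + (t - s) := by
    rcases min_cases s b with h' | h' <;> linarith [min_le_left t b, min_le_right t b]
  have h2 : max 0 (min t b - a) ≤ max 0 (min s b - a) + (t - s) :=
    max_le (by linarith [le_max_left 0 (min s b - a)])
      (by linarith [le_max_right 0 (min s b - a)])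
  linarith

lemma isAbsolutelyContinuous_ramp (hr : 0 ≤ r) : IsAbsolutelyContinuous (ramp r a b) := by
  intro ε hε
  refine ⟨ε / (r + 1), by positivity, fun n x y hxy _ hsum => ?_⟩
  calc ∑ i, |ramp r a b (y i) - ramp r a b (x i)| ≤ ∑ i, r * (y i - x i) := by
        refine Finset.sum_le_sum fun i _ => ?_
        rw [abs_of_nonneg (sub_nonneg.2 (ramp_mono hr (hxy i)))]
        exact ramp_sub_le hr (hxy i)
    _ = r * ∑ i, (y i - x i) := by rw [Finset.mul_sum]
    _ ≤ r * (ε / (r + 1)) := mul_le_mul_of_nonneg_left hsum.le hr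
    _ < ε := by
        rw [mul_div_assoc', div_lt_iff₀ (by positivity)]
        linarith

/-- A ramp as an arrival profile. -/
def rampProfile {Λ : ℝ} (hr : 0 ≤ r) (hab : a ≤ b) (hΛ : r * (b - a) = Λ) : ArrivalProfile Λ where
  F := ramp r a b
  mono := ramp_mono hr
  rightCont _ := continuous_ramp.continuousWithinAt
  tendsto_bot := tendsto_const_nhds.congr' <|
    (eventually_le_atBot a).mono fun _ h => (ramp_of_le h).symm
  tendsto_top := tendsto_const_nhds.congr' <|
    (eventually_ge_atTop b).mono fun _ h => ((ramp_of_ge hab h).trans hΛ).symm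
  mem_Icc t := ⟨mul_nonneg hr (le_max_left _ _), by
    rw [← hΛ, ← ramp_of_ge hab (le_max_right t b)]
    exact ramp_mono hr (le_max_left t b)⟩
  decomp := ⟨ramp r a b, fun _ => 0, ramp_mono hr, isAbsolutelyContinuous_ramp hr,
    monotone_const, ⟨∅, countable_empty, fun _ _ _ _ => rfl⟩, by simp⟩

lemma isCumulative_ramp (hr : 0 ≤ r) (hab : a ≤ b) : IsCumulative (ramp r a b) :=
  (rampProfile hr hab rfl).isCumulative

lemma mem_Icc_of_mem_suppF_ramp (hr : 0 ≤ r) (hab : a ≤ b) {t : ℝ}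
    (ht : t ∈ suppF (ramp r a b)) : t ∈ Icc a b :=
  ⟨ge_of_mem_suppF (isCumulative_ramp hr hab) (fun _ h => ramp_of_le h.le) ht,
    le_of_mem_suppF (isCumulative_ramp hr hab) (fun s => ((rampProfile hr hab rfl).mem_Icc s).2)
      (ramp_of_ge hab le_rfl) ht⟩

end Ramp

/-- The break points of the equilibrium ramps; `v` is the time at which class 2 starts to leave
queue 1. -/
structure HDS.RampTimes (μ₁ μ₂ γ₁ γ₂ a b f v : ℝ) : Prop where
  μ₁_pos : 0 < μ₁
  μ₂_pos : 0 < μ₂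
  μ_lt : μ₂ < μ₁
  γ₁_pos : 0 < γ₁
  γ₁_lt : γ₁ < 1
  γ₂_pos : 0 < γ₂
  γ₂_lt : γ₂ < 1
  rate_le : μ₁ * γ₁ ≤ μ₂ * γ₂
  v_pos : 0 < v
  b_lt : b < f
  b_le_v : b ≤ v
  v_eq : v = γ₁ * (b - a)
  f_eq : f = v + γ₂ * (f - b)

namespace HDS.RampTimes

variable {μ₁ μ₂ γ₁ γ₂ a b f v : ℝ}

local notation "F₁" => ramp (μ₁ * γ₁) a b
local notation "F₂" => ramp (μ₂ * γ₂) b f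
local notation "A₁" => A1 (ramp (μ₁ * γ₁) a b) (ramp (μ₂ * γ₂) b f)
local notation "τ₁" => depart μ₁ (A1 (ramp (μ₁ * γ₁) a b) (ramp (μ₂ * γ₂) b f))
local notation "A₂" => A2 μ₁ (ramp (μ₁ * γ₁) a b) (ramp (μ₂ * γ₂) b f)
local notation "τ₂" => depart μ₂ (A2 μ₁ (ramp (μ₁ * γ₁) a b) (ramp (μ₂ * γ₂) b f))

lemma a_le (R : RampTimes μ₁ μ₂ γ₁ γ₂ a b f v) : a ≤ b := by
  have : 0 < γ₁ * (b - a) := R.v_eq ▸ R.v_pos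
  linarith [pos_of_mul_pos_right this R.γ₁_pos.le]

lemma r₁ (R : RampTimes μ₁ μ₂ γ₁ γ₂ a b f v) : 0 < μ₁ * γ₁ := mul_pos R.μ₁_pos R.γ₁_pos

lemma r₂ (R : RampTimes μ₁ μ₂ γ₁ γ₂ a b f v) : 0 < μ₂ * γ₂ := mul_pos R.μ₂_pos R.γ₂_pos

lemma γ_le (R : RampTimes μ₁ μ₂ γ₁ γ₂ a b f v) : γ₁ ≤ γ₂ :=
  le_of_mul_le_mul_left
    (R.rate_le.trans (mul_le_mul_of_nonneg_right R.μ_lt.le R.γ₂_pos.le)) R.μ₁_pos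

lemma cum₁ (R : RampTimes μ₁ μ₂ γ₁ γ₂ a b f v) : IsCumulative F₁ :=
  isCumulative_ramp R.r₁.le R.a_le

lemma cum₂ (R : RampTimes μ₁ μ₂ γ₁ γ₂ a b f v) : IsCumulative F₂ :=
  isCumulative_ramp R.r₂.le R.b_lt.le

lemma cumA (R : RampTimes μ₁ μ₂ γ₁ γ₂ a b f v) : IsCumulative A₁ :=
  isCumulative_A1 R.cum₁ R.cum₂

lemma inpA (R : RampTimes μ₁ μ₂ γ₁ γ₂ a b f v) : IsInput A₂ :=
  isInput_A2 R.μ₁_pos R.cum₁ R.cum₂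

lemma F1_eq (R : RampTimes μ₁ μ₂ γ₁ γ₂ a b f v) {t : ℝ} (ht : b ≤ t) : F₁ t = μ₁ * v := by
  rw [ramp_of_ge R.a_le ht, R.v_eq]
  ring

lemma F1_le (R : RampTimes μ₁ μ₂ γ₁ γ₂ a b f v) (t : ℝ) : F₁ t ≤ μ₁ * v :=
  (ramp_mono R.r₁.le (le_max_left t b)).trans (R.F1_eq (le_max_right t b)).le

lemma F2_le (R : RampTimes μ₁ μ₂ γ₁ γ₂ a b f v) (t : ℝ) : F₂ t ≤ μ₂ * γ₂ * (f - b) :=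
  (ramp_mono R.r₂.le (le_max_left t f)).trans (ramp_of_ge R.b_lt.le (le_max_right t f)).le

lemma A1_sub_le (R : RampTimes μ₁ μ₂ γ₁ γ₂ a b f v) {s t : ℝ} (h : s ≤ t) :
    A₁ t - A₁ s ≤ μ₁ * (t - s) := by
  have hs : A₁ s = F₁ s + F₂ s := rfl
  have ht : A₁ t = F₁ t + F₂ t := rfl
  have hr₁ : μ₁ * γ₁ ≤ μ₁ := mul_le_of_le_one_right R.μ₁_pos.le R.γ₁_lt.le
  have hr₂ : μ₂ * γ₂ ≤ μ₁ := (mul_le_of_le_one_right R.μ₂_pos.le R.γ₂_lt.le).trans R.μ_lt.le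
  have e1 : F₁ t - F₁ s ≤ μ₁ * (min t b - min s b) := by
    have h1 : ∀ x, F₁ (min x b) = F₁ x := fun x => by simp only [ramp, min_assoc, min_self]
    rw [← h1 t, ← h1 s]
    have h2 : min s b ≤ min t b := min_le_min h le_rfl
    exact (ramp_sub_le R.r₁.le h2).trans (mul_le_mul_of_nonneg_right hr₁ (by linarith))
  have e2 : F₂ t - F₂ s ≤ μ₁ * (max t b - max s b) := by
    have h1 : ∀ x, F₂ (max x b) = F₂ x := fun x => by
      rcases le_total x b with h | h
      · rw [max_eq_right h, ramp_of_le h, ramp_of_le le_rfl]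
      · rw [max_eq_left h]
    rw [← h1 t, ← h1 s]
    have h2 : max s b ≤ max t b := max_le_max h le_rfl
    exact (ramp_sub_le R.r₂.le h2).trans (mul_le_mul_of_nonneg_right hr₂ (by linarith))
  have e3 : μ₁ * (min t b + max t b) = μ₁ * (t + b) := by rw [min_add_max]
  have e4 : μ₁ * (min s b + max s b) = μ₁ * (s + b) := by rw [min_add_max]
  linarith

lemma A1_add_idle_le (R : RampTimes μ₁ μ₂ γ₁ γ₂ a b f v) (t : ℝ) :
    A₁ t + idle μ₁ A₁ t ≤ max (A₁ t) (μ₁ * t) := by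
  have : idle μ₁ A₁ t ≤ max 0 (μ₁ * t - A₁ t) :=
    idle_le (le_max_left _ _) fun s _ hs => le_max_of_le_right (by linarith [R.A1_sub_le hs])
  rcases le_max_iff.1 this with h | h
  · exact le_max_of_le_left (by linarith)
  · exact le_max_of_le_right (by linarith)

lemma mul_tau1_le (R : RampTimes μ₁ μ₂ γ₁ γ₂ a b f v) (t : ℝ) :
    μ₁ * τ₁ t ≤ max (A₁ t) (μ₁ * t) :=
  (R.cumA.mul_depart_le R.μ₁_pos t).trans (R.A1_add_idle_le t)

lemma A1_le_mul_tau1 (R : RampTimes μ₁ μ₂ γ₁ γ₂ a b f v) (t : ℝ) : A₁ t ≤ μ₁ * τ₁ t := by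
  have hc : Continuous A₁ := continuous_ramp.add continuous_ramp
  rw [depart_eq R.μ₁_pos R.cumA.isInput (hc.continuousAt.tendsto.mono_left nhdsWithin_le_nhds)
    hc.continuousWithinAt]
  linarith [idle_nonneg μ₁ A₁ t]

lemma tau1_ge (R : RampTimes μ₁ μ₂ γ₁ γ₂ a b f v) (t : ℝ) : γ₁ * (t - a) ≤ τ₁ t := by
  have hA : A₁ t = F₁ t + F₂ t := rfl
  have h1 := R.A1_le_mul_tau1 t
  have hv := R.v_eq
  rcases le_total t b with htb | hbt
  · refine le_of_mul_le_mul_left ?_ R.μ₁_pos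
    linarith [le_ramp R.r₁.le (a := a) htb, R.cum₂.nonneg t]
  rcases le_total t f with htf | hft
  · refine le_of_mul_le_mul_left ?_ R.μ₁_pos
    rw [hA, R.F1_eq hbt, ramp_of_mem hbt htf, hv] at h1
    have := mul_le_mul_of_nonneg_right R.rate_le (sub_nonneg.2 hbt)
    linarith
  · refine le_trans ?_ (le_depart R.μ₁_pos R.cumA.nonneg t)
    have h2 := R.f_eq
    have h3 := mul_le_mul_of_nonneg_right R.γ_le (sub_nonneg.2 R.b_lt.le)
    have h4 := mul_le_mul_of_nonneg_right R.γ₁_lt.le (sub_nonneg.2 hft)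
    linarith

lemma tau1_eq (R : RampTimes μ₁ μ₂ γ₁ γ₂ a b f v) {t : ℝ} (ha : a ≤ t) (hb : t ≤ b) :
    τ₁ t = γ₁ * (t - a) := by
  refine le_antisymm (le_of_mul_le_mul_left ((R.mul_tau1_le t).trans ?_) R.μ₁_pos) (R.tau1_ge t)
  have hA : A₁ t = F₁ t + F₂ t := rfl
  rw [hA, ramp_of_mem ha hb, ramp_of_le hb]
  refine max_le (by linarith) (mul_le_mul_of_nonneg_left ?_ R.μ₁_pos.le)
  have h1 := mul_le_mul_of_nonneg_right R.γ₁_lt.le (sub_nonneg.2 hb)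
  linarith [R.v_eq, R.b_le_v]

lemma tau1_lt (R : RampTimes μ₁ μ₂ γ₁ γ₂ a b f v) {s t : ℝ} (hs : b ≤ s) (hst : s < t)
    (ht : t ≤ f) : τ₁ s < τ₁ t := by
  have hAs : A₁ s = F₁ s + F₂ s := rfl
  have hAt : A₁ t = F₁ t + F₂ t := rfl
  rw [R.F1_eq hs, ramp_of_mem hs (hst.le.trans ht)] at hAs
  rw [R.F1_eq (hs.trans hst.le), ramp_of_mem (hs.trans hst.le) ht] at hAt
  refine lt_of_mul_lt_mul_left ((R.mul_tau1_le s).trans_lt (max_lt ?_ ?_)) R.μ₁_pos.le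
  · refine lt_of_lt_of_le ?_ (R.A1_le_mul_tau1 t)
    have := mul_lt_mul_of_pos_left hst R.r₂
    linarith
  · exact mul_lt_mul_of_pos_left
      (hst.trans_le (le_depart R.μ₁_pos R.cumA.nonneg t)) R.μ₁_pos

lemma tau1_le_f (R : RampTimes μ₁ μ₂ γ₁ γ₂ a b f v) {t : ℝ} (ht : t ≤ f) : τ₁ t ≤ f := by
  refine le_of_mul_le_mul_left ((R.mul_tau1_le t).trans
    (max_le ?_ (mul_le_mul_of_nonneg_left ht R.μ₁_pos.le))) R.μ₁_pos
  have hAt : A₁ t = F₁ t + F₂ t := rfl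
  have h1 := mul_le_mul_of_nonneg_right R.μ_lt.le
    (mul_nonneg R.γ₂_pos.le (sub_nonneg.2 R.b_lt.le))
  have h2 : μ₁ * f = μ₁ * (v + γ₂ * (f - b)) := by rw [← R.f_eq]
  linarith [R.F1_le t, R.F2_le t]

lemma v_le_tau1 (R : RampTimes μ₁ μ₂ γ₁ γ₂ a b f v) {t : ℝ} (ht : b ≤ t) : v ≤ τ₁ t := by
  have := mul_le_mul_of_nonneg_left (sub_le_sub_right ht a) R.γ₁_pos.le
  linarith [R.tau1_ge t, R.v_eq]

lemma le_idle2 (R : RampTimes μ₁ μ₂ γ₁ γ₂ a b f v) {x : ℝ} (hx : v ≤ x) :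
    μ₂ * v ≤ idle μ₂ A₂ x := by
  have key : ∀ s < v, s ≤ idle μ₂ A₂ x / μ₂ := fun s hs => by
    rw [le_div_iff₀ R.μ₂_pos, mul_comm]
    rcases le_or_gt s 0 with h0 | h0
    · exact (mul_nonpos_of_nonneg_of_nonpos R.μ₂_pos.le h0).trans (idle_nonneg _ _ _)
    obtain ⟨r, hr, hrb⟩ := exists_between (show s / γ₁ + a < b by
      rw [← lt_sub_iff_add_lt, div_lt_iff₀ R.γ₁_pos]
      linarith [R.v_eq])
    rw [← lt_sub_iff_add_lt, div_lt_iff₀ R.γ₁_pos] at hr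
    have h1 : A₂ s ≤ F₂ r := R.cum₂.mono
      (R.cumA.departInv_le R.μ₁_pos h0 (by linarith [R.tau1_ge r]))
    rw [ramp_of_le hrb.le] at h1
    have h2 := le_idle R.μ₂_pos R.inpA.nonneg h0.le (hs.le.trans hx)
    linarith
  have := le_of_forall_lt_imp_le_of_dense key
  rwa [le_div_iff₀ R.μ₂_pos, mul_comm] at this

lemma idle2_le (R : RampTimes μ₁ μ₂ γ₁ γ₂ a b f v) {x : ℝ} (hx : x ≤ f) :
    idle μ₂ A₂ x ≤ μ₂ * v := by
  refine idle_le (mul_nonneg R.μ₂_pos.le R.v_pos.le) fun s _ hs => ?_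
  rcases le_or_gt s v with hsv | hsv
  · linarith [R.inpA.nonneg s, mul_le_mul_of_nonneg_left hsv R.μ₂_pos.le]
  have h1 := (R.cumA.mul_le_at_departInv R.μ₁_pos s).trans (R.A1_add_idle_le _)
  have h2 : A₁ (departInv μ₁ A₁ s) = F₁ (departInv μ₁ A₁ s) + A₂ s := rfl
  rcases le_max_iff.1 h1 with h | h
  · have := mul_le_mul_of_nonneg_right R.μ_lt.le (sub_nonneg.2 hsv.le)
    linarith [R.F1_le (departInv μ₁ A₁ s)]
  · have h3 : F₂ s ≤ A₂ s := R.cum₂.mono (le_of_mul_le_mul_left h R.μ₁_pos)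
    have hsf := hs.trans hx
    rw [ramp_of_mem (R.b_le_v.trans hsv.le) hsf] at h3
    have h4 := mul_le_mul_of_nonneg_right R.γ₂_lt.le (sub_nonneg.2 hsf)
    have h5 : s - v ≤ γ₂ * (s - b) := by linarith [R.f_eq]
    have h6 := mul_le_mul_of_nonneg_left h5 R.μ₂_pos.le
    linarith

lemma tau2_ge (R : RampTimes μ₁ μ₂ γ₁ γ₂ a b f v) (t : ℝ) :
    v + γ₂ * (t - b) ≤ τ₂ (τ₁ t) := by
  have hx := le_depart R.μ₂_pos R.inpA.nonneg (τ₁ t)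
  rcases le_or_gt t b with htb | hbt
  · have := mul_le_mul_of_nonneg_right R.γ_le (sub_nonneg.2 htb)
    linarith [R.tau1_ge t, R.v_eq]
  rcases le_or_gt t f with htf | hft
  · have hvx := R.v_le_tau1 hbt.le
    have hx0 := R.v_pos.trans_le hvx
    have key : ∀ s < t, s ≤ (τ₂ (τ₁ t) - v) / γ₂ + b := fun s hs => by
      obtain ⟨r, hr, hrt⟩ := exists_between (max_lt hs hbt)
      obtain ⟨hsr, hbr⟩ := max_lt_iff.1 hr
      have h1 := le_depart_of_lt R.μ₂_pos R.inpA (depart_nonneg R.μ₁_pos R.cumA.nonneg r)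
        (R.tau1_lt hbr.le hrt htf) (right_A2 R.μ₁_pos R.cum₁ R.cum₂ hx0) (B := F₂ r)
        fun q hq _ => R.cum₂.mono (le_departInv R.μ₁_pos R.cumA.nonneg hq.le)
      rw [ramp_of_mem hbr.le (hrt.le.trans htf)] at h1
      have h2 := R.le_idle2 hvx
      have h3 : γ₂ * (r - b) + v ≤ τ₂ (τ₁ t) :=
        le_of_mul_le_mul_left (by linarith) R.μ₂_pos
      refine hsr.le.trans ?_
      rw [← sub_le_iff_le_add, le_div_iff₀ R.γ₂_pos]
      linarith
    have := le_of_forall_lt_imp_le_of_dense key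
    rw [← sub_le_iff_le_add, le_div_iff₀ R.γ₂_pos] at this
    linarith
  · have h1 := le_depart R.μ₁_pos R.cumA.nonneg t
    have h2 := mul_le_mul_of_nonneg_right R.γ₂_lt.le (sub_nonneg.2 hft.le)
    linarith [R.f_eq]

lemma tau2_le (R : RampTimes μ₁ μ₂ γ₁ γ₂ a b f v) {t : ℝ} (hb : b ≤ t) (hf : t ≤ f) :
    τ₂ (τ₁ t) ≤ v + γ₂ * (t - b) := by
  have hx0 := R.v_pos.trans_le (R.v_le_tau1 hb)
  have hA : A₂ (τ₁ t) ≤ F₂ t := by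
    rcases hf.eq_or_lt with rfl | hlt
    · rw [ramp_of_mem R.b_lt.le le_rfl]
      exact R.F2_le _
    · refine R.cum₂.mono (le_of_forall_gt_imp_ge_of_dense fun r hr => ?_)
      refine le_trans ?_ (min_le_left r f)
      exact R.cumA.departInv_le R.μ₁_pos hx0 (R.tau1_lt hb (lt_min hr hlt) (min_le_right r f))
  rw [ramp_of_mem hb hf] at hA
  have h1 := depart_le R.μ₂_pos R.inpA hx0 (right_A2 R.μ₁_pos R.cum₁ R.cum₂ hx0)
  have h2 := R.idle2_le (R.tau1_le_f hf)
  exact le_of_mul_le_mul_left (by linarith) R.μ₂_pos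

/-- The ramps form an equilibrium. -/
lemma isEAP (R : RampTimes μ₁ μ₂ γ₁ γ₂ a b f v) {Λ₁ Λ₂ : ℝ} (P₁ : ArrivalProfile Λ₁)
    (P₂ : ArrivalProfile Λ₂) (h₁ : P₁.F = F₁) (h₂ : P₂.F = F₂) :
    IsEAP μ₁ μ₂ γ₁ γ₂ Λ₁ Λ₂ P₁ P₂ := by
  rw [IsEAP, h₁, h₂]
  refine ⟨fun t ht s => ?_, fun t ht s => ?_⟩
  · have hm := mem_Icc_of_mem_suppF_ramp R.r₁.le R.a_le ht
    rw [cost1_eq, cost1_eq, R.tau1_eq hm.1 hm.2]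
    linarith [R.tau1_ge s]
  · have hm := mem_Icc_of_mem_suppF_ramp R.r₂.le R.b_lt.le ht
    rw [cost2_eq, cost2_eq]
    linarith [R.tau2_le hm.1 hm.2, R.tau2_ge s]

end HDS.RampTimes

/-- If `μ1 > μ2`, `γ1 ≠ γ2` and `γ1 ≤ (μ2/μ1)γ2`, the unique EAP
of the HDS is the piecewise-linear profile with `F1′ = μ1γ1` on `[T_{1,a}, T_{1,f}]`
and `F2′ = μ2γ2` on `[T_{2,a}, T_{2,f}]` (zero elsewhere), with the indicated
support boundaries. -/
theorem stmt8 (μ1 μ2 γ1 γ2 Λ1 Λ2 : ℝ)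
    (hμ1 : 0 < μ1) (hμ2 : 0 < μ2) (hμ : μ2 < μ1)
    (hγ1 : γ1 ∈ Set.Ioo (0 : ℝ) 1) (hγ2 : γ2 ∈ Set.Ioo (0 : ℝ) 1) (hγ : γ1 ≠ γ2)
    (hle : γ1 ≤ μ2 / μ1 * γ2)
    (hΛ1 : 0 < Λ1) (hΛ2 : 0 < Λ2) :
    (∃ (P1 : ArrivalProfile Λ1) (P2 : ArrivalProfile Λ2),
        HDS.IsEAP μ1 μ2 γ1 γ2 Λ1 Λ2 P1 P2 ∧
        P1.F = ramp (μ1 * γ1) (s8T1a μ1 μ2 γ1 γ2 Λ1 Λ2) (s8T1f μ1 μ2 γ1 γ2 Λ1 Λ2) ∧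
        P2.F = ramp (μ2 * γ2) (s8T1f μ1 μ2 γ1 γ2 Λ1 Λ2) (s8T2f μ1 μ2 γ1 γ2 Λ1 Λ2)) ∧
    (∀ (P1 : ArrivalProfile Λ1) (P2 : ArrivalProfile Λ2),
        HDS.IsEAP μ1 μ2 γ1 γ2 Λ1 Λ2 P1 P2 →
        P1.F = ramp (μ1 * γ1) (s8T1a μ1 μ2 γ1 γ2 Λ1 Λ2) (s8T1f μ1 μ2 γ1 γ2 Λ1 Λ2) ∧
        P2.F = ramp (μ2 * γ2) (s8T1f μ1 μ2 γ1 γ2 Λ1 Λ2) (s8T2f μ1 μ2 γ1 γ2 Λ1 Λ2)) := by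
  have hrate : μ1 * γ1 ≤ μ2 * γ2 := by
    have := mul_le_mul_of_nonneg_left hle hμ1.le
    rwa [← mul_assoc, mul_div_cancel₀ _ hμ1.ne'] at this
  refine ⟨?_, fun P1 P2 hE => hE.eq_ramp hμ1 hμ2 hμ hγ1 hγ2 hrate hΛ1 hΛ2⟩
  have hγ1' := hγ1.1.ne'
  have hγ2' := hγ2.1.ne'
  have hv : 0 < Λ1 / μ1 := div_pos hΛ1 hμ1
  have hκ : 0 < Λ2 / μ2 := div_pos hΛ2 hμ2
  have hinv : 0 < 1 / γ2 - 1 := sub_pos.2 ((one_lt_div hγ2.1).2 hγ2.2)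
  have hba : γ1 * (s8T1f μ1 μ2 γ1 γ2 Λ1 Λ2 - s8T1a μ1 μ2 γ1 γ2 Λ1 Λ2) = Λ1 / μ1 := by
    rw [s8T1f, s8T1a]
    field_simp
    ring
  have hfb : γ2 * (s8T2f μ1 μ2 γ1 γ2 Λ1 Λ2 - s8T1f μ1 μ2 γ1 γ2 Λ1 Λ2) = Λ2 / μ2 := by
    rw [s8T1f, s8T2f]
    field_simp
    ring
  have hbv : s8T1f μ1 μ2 γ1 γ2 Λ1 Λ2 ≤ Λ1 / μ1 := by
    rw [s8T1f]
    linarith [mul_pos hinv hκ]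
  have hvf : s8T2f μ1 μ2 γ1 γ2 Λ1 Λ2 = Λ1 / μ1 + Λ2 / μ2 := rfl
  have R : HDS.RampTimes μ1 μ2 γ1 γ2 (s8T1a μ1 μ2 γ1 γ2 Λ1 Λ2) (s8T1f μ1 μ2 γ1 γ2 Λ1 Λ2)
      (s8T2f μ1 μ2 γ1 γ2 Λ1 Λ2) (Λ1 / μ1) :=
    { μ₁_pos := hμ1
      μ₂_pos := hμ2
      μ_lt := hμ
      γ₁_pos := hγ1.1
      γ₁_lt := hγ1.2
      γ₂_pos := hγ2.1
      γ₂_lt := hγ2.2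
      rate_le := hrate
      v_pos := hv
      b_lt := by linarith
      b_le_v := hbv
      v_eq := hba.symm
      f_eq := by rw [hfb, hvf] }
  exact ⟨rampProfile R.r₁.le R.a_le (by rw [mul_assoc, hba, mul_div_cancel₀ _ hμ1.ne']),
    rampProfile R.r₂.le R.b_lt.le (by rw [mul_assoc, hfb, mul_div_cancel₀ _ hμ2.ne']),
    R.isEAP _ _ rfl rfl, rfl, rfl⟩
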